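/- arXiv:1008.3854 — 2 statements merged into one kernel-verified Lean document; each statement's English description precedes it below -/
import Mathlib

section
/- Let c > 0, let a < min{−1+c/2, −1/(2c)} and b > 1+c/2, and set I_c(s) = ∫_a^b φ₀(s−t)·Ω_c′(t) dt with φ₀(x) = −ln|2x|. Then ∫_a^b I_c(s)·Ω_c′(s) ds = 1 − c²/4 − 2φ₂(b−a) + 2∫_a^b G_c(s)·Ω_c′(s) ds − 2∫_a^b H_c(s)·Ω_c′(s) ds + [c>1]·( 1 − 5/(4c²) + c²/4 − (2 + 1/c²)·ln c ), where [c>1] equals 1 if c > 1 and 0 otherwise. -/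
open MeasureTheory Real Filter Topology
open scoped Classical

noncomputable section

/-- The function `h(c,s)` defining the curved part of the limit shape, for
`2s ∈ [c−2, c+2]` (with the continuous extension at `c = 0`). -/
def hshape (c s : ℝ) : ℝ :=
  if c = 0 then (2/π) * (s * Real.arcsin s + Real.sqrt (1 - s^2))
  else (2/π) * (s * Real.arcsin ((2*s+c)/(2*Real.sqrt (1+2*s*c)))
      + (1/(2*c)) * Real.arccos ((2+2*s*c-c^2)/(2*Real.sqrt (1+2*s*c)))
      + (1/4) * Real.sqrt (4-(2*s-c)^2))

/-- Biane's limit shape `Ω_c`. -/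
def Omega (c : ℝ) (s : ℝ) : ℝ :=
  if c ≤ 1 then (if c - 2 ≤ 2*s ∧ 2*s ≤ c + 2 then hshape c s else |s|)
  else if -(1/c) ≤ 2*s ∧ 2*s ≤ c - 2 then s + 1/c
  else if c - 2 ≤ 2*s ∧ 2*s ≤ c + 2 then hshape c s else |s|

/-- The inverse hyperbolic cosine `arccosh x = ln(x + √(x²−1))` (for `x ≥ 1`). -/
def arccosh (x : ℝ) : ℝ := Real.log (x + Real.sqrt (x^2 - 1))

/-- The function `H̃_c`: zero on `[−1,1]`, and the stated combination of
`arccosh` terms for `|z| > 1`. -/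
def Htilde (c z : ℝ) : ℝ :=
  if |z| ≤ 1 then 0 else
    (z - (1 - c^2)/(2*c)) * arccosh |z|
    + Real.sign (1 - c) * (z + (1 + c^2)/(2*c)) *
        arccosh |(1 + ((1+c^2)/(2*c))*z)/(z + (1+c^2)/(2*c))|
    - Real.sign z * Real.sqrt (z^2 - 1)

/-- `H_c(s) = H̃_c(s − c/2)`. -/
def Hc (c s : ℝ) : ℝ := Htilde c (s - c/2)

/-- `φ₀(x) = −ln|2x|`. -/
def phi0 (x : ℝ) : ℝ := -Real.log |2*x|

/-- `φ₁(x) = x − x·ln|2x|` (an antiderivative of `φ₀`, with `φ₁(0) = 0`). -/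
def phi1 (x : ℝ) : ℝ := x - x * Real.log |2*x|

/-- `φ₂(x) = (3/4)x² − (1/2)x²·ln(2|x|)` (an antiderivative of `φ₁`, `φ₂(0) = 0`). -/
def phi2 (x : ℝ) : ℝ := (3/4)*x^2 - (1/2)*x^2*Real.log (2*|x|)

/-- `G_c(s) = (1/c)·φ₁((1+2cs)/2) − (1−c²)/(2c)`. -/
def Gc (c s : ℝ) : ℝ := (1/c) * phi1 ((1+2*c*s)/2) - (1-c^2)/(2*c)


def Ar (r z : ℝ) : ℝ := Real.arctan (r * Real.sqrt (1 - z^2) / (1 + r * z))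

def sg (x : ℝ) : ℝ := if x < 0 then -1 else 1

lemma phi0_eq (x : ℝ) : phi0 x = -Real.log (2*x) := by
  unfold phi0; rw [Real.log_abs]

lemma phi1_eq (x : ℝ) : phi1 x = x - x * Real.log (2*x) := by
  unfold phi1; rw [Real.log_abs]

lemma phi2_eq (x : ℝ) : phi2 x = (3/4)*x^2 - (1/2)*x^2*Real.log (2*x) := by
  unfold phi2
  have : 2*|x| = |2*x| := by rw [abs_mul]; norm_num
  rw [this, Real.log_abs]

lemma phi2_neg (x : ℝ) : phi2 (-x) = phi2 x := by
  unfold phi2; simp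

lemma phi1_neg (x : ℝ) : phi1 (-x) = -phi1 x := by
  unfold phi1; simp; ring

lemma phi1_cont : Continuous phi1 := by
  have : phi1 = fun x => x - (1/2) * ((2*x) * Real.log (2*x)) := by
    funext x; rw [phi1_eq]; ring
  rw [this]
  exact continuous_id.sub (continuous_const.mul (Real.continuous_mul_log.comp (by fun_prop)))

lemma phi2_cont : Continuous phi2 := by
  have : phi2 = fun x => (3/4)*x^2 - (1/4) * x * ((2*x) * Real.log (2*x)) := by
    funext x; rw [phi2_eq]; ring
  rw [this]
  have h := Real.continuous_mul_log.comp (show Continuous (fun x : ℝ => 2*x) by fun_prop)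
  exact (by fun_prop : Continuous fun x : ℝ => (3/4)*x^2).sub
    ((by fun_prop : Continuous fun x : ℝ => (1/4)*x).mul h)

lemma phi1_deriv {x : ℝ} (hx : x ≠ 0) : HasDerivAt phi1 (phi0 x) x := by
  have : phi1 = fun x => x - x * Real.log (2*x) := by funext x; exact phi1_eq x
  rw [this, phi0_eq]
  have h1 : HasDerivAt (fun x : ℝ => 2*x) 2 x := by simpa using (hasDerivAt_id x).const_mul 2
  have h2 := (hasDerivAt_id x).sub ((hasDerivAt_id x).mul (h1.log (by simpa using hx)))
  convert! h2 using 1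
  simp; field_simp; ring

lemma phi2_deriv {x : ℝ} (hx : x ≠ 0) : HasDerivAt phi2 (phi1 x) x := by
  have : phi2 = fun x => (3/4)*x^2 - (1/2)*x^2*Real.log (2*x) := by funext x; exact phi2_eq x
  rw [this, phi1_eq]
  have h1 : HasDerivAt (fun x : ℝ => 2*x) 2 x := by simpa using (hasDerivAt_id x).const_mul 2
  have h3 : HasDerivAt (fun x : ℝ => x^2) (2*x) x := by simpa using hasDerivAt_pow 2 x
  have h2 := (h3.const_mul (3/4)).sub ((h3.const_mul (1/2)).mul (h1.log (by simpa using hx)))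
  convert! h2 using 1
  field_simp; ring

lemma phi0_meas : Measurable phi0 := by
  unfold phi0
  exact (Real.measurable_log.comp (by fun_prop)).neg

lemma phi0_int (a b : ℝ) : IntervalIntegrable phi0 volume a b := by
  have : phi0 = fun x => -Real.log (2*x) := by funext x; exact phi0_eq x
  rw [this]
  have h : IntervalIntegrable Real.log volume (2*a) (2*b) := intervalIntegral.intervalIntegrable_log'
  have h2 := (h.comp_mul_left (c := 2)).neg
  simp only [ne_eq, OfNat.ofNat_ne_zero, not_false_eq_true, mul_div_cancel_left₀] at h2
  exact h2

lemma phi0_shift_int (s a b : ℝ) : IntervalIntegrable (fun t => phi0 (s - t)) volume a b := by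
  simpa using (phi0_int (s-a) (s-b)).comp_sub_left s

lemma int_phi0 (s a b : ℝ) : ∫ t in a..b, phi0 (s - t) = phi1 (s-a) - phi1 (s-b) := by
  have := MeasureTheory.integral_eq_of_hasDerivAt_off_countable (fun t => -phi1 (s-t))
    (fun t => phi0 (s-t)) (a := a) (b := b) (s := {s}) (Set.countable_singleton s)
    ((phi1_cont.comp (by fun_prop)).neg.continuousOn) (by
      intro x hx
      have h0 : s - x ≠ 0 := by
        intro h; exact hx.2 (by simp; linarith)
      have h1 : HasDerivAt (fun t : ℝ => s - t) (-1) x := by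
        simpa using (hasDerivAt_id x).const_sub s
      have := ((phi1_deriv h0).comp x h1).neg
      convert! this using 1; ring) (phi0_shift_int s a b)
  rw [this]; ring

lemma int_phi1 (s a b : ℝ) : ∫ t in a..b, phi1 (t - s) = phi2 (b-s) - phi2 (a-s) := by
  have := MeasureTheory.integral_eq_of_hasDerivAt_off_countable (fun t => phi2 (t-s))
    (fun t => phi1 (t-s)) (a := a) (b := b) (s := {s}) (Set.countable_singleton s)
    ((phi2_cont.comp (by fun_prop)).continuousOn) (by
      intro x hx
      have h0 : x - s ≠ 0 := by
        intro h; exact hx.2 (by simp; linarith)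
      have h1 : HasDerivAt (fun t : ℝ => t - s) (1) x := by
        simpa using (hasDerivAt_id x).sub_const s
      have := ((phi2_deriv h0).comp x h1)
      convert! this using 1; ring) ((phi1_cont.comp (by fun_prop)).intervalIntegrable _ _)
  rw [this]

lemma sg_meas : Measurable sg := by
  unfold sg
  exact Measurable.ite (measurableSet_lt measurable_id measurable_const) measurable_const
    measurable_const

lemma sg_abs (x : ℝ) : |sg x| ≤ 1 := by
  unfold sg; split_ifs <;> simp

lemma sg_split {a b x0 : ℝ} (ha : a < x0) (hb : x0 < b) (g : ℝ → ℝ)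
    (hg : ∀ p q, IntervalIntegrable g volume p q) :
    ∫ t in a..b, g t * sg (t - x0) = (∫ t in x0..b, g t) - ∫ t in a..x0, g t := by
  have e1 : ∫ t in a..x0, g t * sg (t - x0) = ∫ t in a..x0, -g t := by
    apply intervalIntegral.integral_congr_Ioo_of_le ha.le
    intro t ht
    have : t - x0 < 0 := by linarith [ht.2]
    simp [sg, this]
  have e2 : ∫ t in x0..b, g t * sg (t - x0) = ∫ t in x0..b, g t := by
    apply intervalIntegral.integral_congr_Ioo_of_le hb.le
    intro t ht
    have : ¬ (t - x0 < 0) := by linarith [ht.1]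
    simp only [sg, this, if_false, mul_one]
  have hI : ∀ p q, IntervalIntegrable (fun t => g t * sg (t - x0)) volume p q := by
    intro p q
    rw [intervalIntegrable_iff]
    exact Integrable.mul_bdd (c := 1) ((intervalIntegrable_iff.1 (hg p q)))
      (sg_meas.comp (by fun_prop)).aestronglyMeasurable
      (Filter.Eventually.of_forall fun t => sg_abs _)
  rw [← intervalIntegral.integral_add_adjacent_intervals (hI a x0) (hI x0 b), e1, e2,
    intervalIntegral.integral_neg]
  ring

lemma phi0_prod_int {a b : ℝ} (hab : a < b) :
    Integrable (fun p : ℝ × ℝ => phi0 (p.1 - p.2))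
      ((volume.restrict (Set.Ioc a b)).prod (volume.restrict (Set.Ioc a b))) := by
  have hf : Integrable (Set.indicator (Set.Ioc a b) (fun _ => (1:ℝ))) volume := by
    rw [integrable_indicator_iff measurableSet_Ioc]
    simp
  have hg : Integrable (Set.indicator (Set.Ioc (a-b) (b-a)) phi0) volume := by
    rw [integrable_indicator_iff measurableSet_Ioc]
    exact (intervalIntegrable_iff_integrableOn_Ioc_of_le (by linarith)).1 (phi0_int _ _)
  have h := hf.convolution_integrand (ContinuousLinearMap.mul ℝ ℝ) hg
  rw [Measure.prod_restrict]
  refine IntegrableOn.congr_fun h.integrableOn ?_ (measurableSet_Ioc.prod measurableSet_Ioc)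
  rintro ⟨s, t⟩ ⟨hs, ht⟩
  simp only [Set.mem_Ioc] at hs ht
  have h1 : s - t ∈ Set.Ioc (a-b) (b-a) := ⟨by linarith, by linarith⟩
  have h2 : t ∈ Set.Ioc a b := ht
  simp [Set.indicator_of_mem h1, Set.indicator_of_mem h2]

lemma abs_main {a b x0 : ℝ} (ha : a < x0) (hb : x0 < b) (v : ℝ → ℝ) (hv : Measurable v)
    (M : ℝ) (hM : ∀ x, |v x| ≤ M) :
    IntervalIntegrable (fun s => (2*phi1 (s-x0) + ∫ t in a..b, phi0 (s-t) * v t)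
      * (sg (s-x0) + v s)) volume a b ∧
    (∫ s in a..b, (∫ t in a..b, phi0 (s-t) * (sg (t-x0) + v t)) * (sg (s-x0) + v s)) =
      -2*phi2 (b-a)
      + 2*(∫ s in a..b, (2*phi1 (s-x0) + ∫ t in a..b, phi0 (s-t) * v t) * (sg (s-x0) + v s))
      - ∫ s in a..b, (4*phi1 (s-x0) + ∫ t in a..b, phi0 (s-t) * v t) * v s := by
  have hab : a < b := ha.trans hb
  set μ := volume.restrict (Set.Ioc a b) with hμ
  set V : ℝ → ℝ := fun s => ∫ t in a..b, phi0 (s-t) * v t with hV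
  set σ : ℝ → ℝ := fun s => sg (s-x0) with hσ
  have hσm : Measurable σ := sg_meas.comp (by fun_prop)
  have hσb : ∀ s, |σ s| ≤ 1 := fun s => sg_abs _
  have hVe : V = fun s => ∫ t, phi0 (s-t) * v t ∂μ := by
    funext s; simp only [hV]; rw [intervalIntegral.integral_of_le hab.le]
  have hP := phi0_prod_int hab
  rw [← hμ] at hP
  have hPv : Integrable (fun p : ℝ × ℝ => phi0 (p.1 - p.2) * v p.2) (μ.prod μ) :=
    hP.mul_bdd (c := M) (hv.comp measurable_snd).aestronglyMeasurable
      (Filter.Eventually.of_forall fun t => hM _)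
  have hPvs : Integrable (fun p : ℝ × ℝ => phi0 (p.1 - p.2) * v p.2 * σ p.1) (μ.prod μ) :=
    hPv.mul_bdd (c := 1) (hσm.comp measurable_fst).aestronglyMeasurable
      (Filter.Eventually.of_forall fun t => hσb _)
  have hVi : Integrable V μ := by rw [hVe]; exact hPv.integral_prod_left
  set Ks : ℝ → ℝ := fun s => -phi1 (s-b) - phi1 (s-a) + 2*phi1 (s-x0) with hKs
  have hKsc : Continuous Ks := by
    have h1 := phi1_cont.comp (show Continuous (fun s : ℝ => s - b) by fun_prop)
    have h2 := phi1_cont.comp (show Continuous (fun s : ℝ => s - a) by fun_prop)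
    have h3 := phi1_cont.comp (show Continuous (fun s : ℝ => s - x0) by fun_prop)
    exact (h1.neg.sub h2).add (continuous_const.mul h3)
  have hK : ∀ s, ∫ t in a..b, phi0 (s-t) * σ t = Ks s := by
    intro s
    simp only [hσ]
    rw [sg_split ha hb (fun t => phi0 (s-t)) (fun p q => phi0_shift_int s p q), int_phi0, int_phi0]
    simp only [hKs]; ring
  have hvI : ∀ s, IntervalIntegrable (fun t => phi0 (s-t) * v t) volume a b := by
    intro s
    rw [intervalIntegrable_iff]
    exact Integrable.mul_bdd (c := M) ((intervalIntegrable_iff.1 (phi0_shift_int s a b)))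
      hv.aestronglyMeasurable (Filter.Eventually.of_forall fun t => hM _)
  have hsI : ∀ s, IntervalIntegrable (fun t => phi0 (s-t) * σ t) volume a b := by
    intro s
    rw [intervalIntegrable_iff]
    exact Integrable.mul_bdd (c := 1) ((intervalIntegrable_iff.1 (phi0_shift_int s a b)))
      hσm.aestronglyMeasurable (Filter.Eventually.of_forall fun t => hσb _)
  have hin : ∀ s, ∫ t in a..b, phi0 (s-t) * (σ t + v t) = Ks s + V s := by
    intro s
    simp only [mul_add]
    rw [intervalIntegral.integral_add (hsI s) (hvI s), hK]
  -- Fubini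
  have hF : ∫ s in a..b, V s * σ s = ∫ s in a..b, Ks s * v s := by
    have h := integral_integral_swap (f := fun s t => phi0 (s - t) * v t * σ s) hPvs
    rw [intervalIntegral.integral_of_le hab.le, intervalIntegral.integral_of_le hab.le, ← hμ]
    have e1 : ∫ s, V s * σ s ∂μ = ∫ s, ∫ t, phi0 (s - t) * v t * σ s ∂μ ∂μ := by
      congr 1; funext s; rw [integral_mul_const, hVe]
    rw [e1, h]
    congr 1; funext t
    rw [← hK t, intervalIntegral.integral_of_le hab.le, ← hμ, ← integral_mul_const]
    congr 1; funext s
    have : phi0 (s - t) = phi0 (t - s) := by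
      unfold phi0; rw [← abs_neg]; congr 3; ring
    rw [this]; ring
  have hP1 : Continuous (fun s : ℝ => phi1 (s - x0)) := phi1_cont.comp (by fun_prop)
  have mk : ∀ f : ℝ → ℝ, Integrable f μ → IntervalIntegrable f volume a b := by
    intro f hf
    exact (intervalIntegrable_iff_integrableOn_Ioc_of_le hab.le).2 hf
  have cI : ∀ f : ℝ → ℝ, Continuous f → Integrable f μ := by
    intro f hf
    exact (intervalIntegrable_iff_integrableOn_Ioc_of_le hab.le).1 (hf.intervalIntegrable _ _)
  have ms : ∀ f : ℝ → ℝ, Integrable f μ → IntervalIntegrable (fun s => f s * σ s) volume a b :=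
    fun f hf => mk _ (hf.mul_bdd (c := 1) hσm.aestronglyMeasurable
      (Filter.Eventually.of_forall fun t => hσb _))
  have mv : ∀ f : ℝ → ℝ, Integrable f μ → IntervalIntegrable (fun s => f s * v s) volume a b :=
    fun f hf => mk _ (hf.mul_bdd (c := M) hv.aestronglyMeasurable
      (Filter.Eventually.of_forall fun t => hM _))
  have e1 : (∫ s in a..b, (Ks s + V s) * (σ s + v s)) = (∫ s in a..b, Ks s * σ s)
      + (∫ s in a..b, Ks s * v s) + (∫ s in a..b, V s * σ s) + (∫ s in a..b, V s * v s) := by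
    rw [← intervalIntegral.integral_add (ms _ (cI _ hKsc)) (mv _ (cI _ hKsc)),
      ← intervalIntegral.integral_add ((ms _ (cI _ hKsc)).add (mv _ (cI _ hKsc))) (ms _ hVi),
      ← intervalIntegral.integral_add (((ms _ (cI _ hKsc)).add (mv _ (cI _ hKsc))).add (ms _ hVi))
        (mv _ hVi)]
    congr 1; funext s; ring
  have e2 : (∫ s in a..b, (2*phi1 (s-x0) + V s) * (σ s + v s)) =
      2*(∫ s in a..b, phi1 (s-x0) * σ s)
      + 2*(∫ s in a..b, phi1 (s-x0) * v s) + (∫ s in a..b, V s * σ s) + (∫ s in a..b, V s * v s) := by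
    rw [← intervalIntegral.integral_const_mul, ← intervalIntegral.integral_const_mul,
      ← intervalIntegral.integral_add ((ms _ (cI _ hP1)).const_mul 2) ((mv _ (cI _ hP1)).const_mul 2),
      ← intervalIntegral.integral_add (((ms _ (cI _ hP1)).const_mul 2).add
        ((mv _ (cI _ hP1)).const_mul 2)) (ms _ hVi),
      ← intervalIntegral.integral_add ((((ms _ (cI _ hP1)).const_mul 2).add
        ((mv _ (cI _ hP1)).const_mul 2)).add (ms _ hVi)) (mv _ hVi)]
    congr 1; funext s; ring
  have e3 : (∫ s in a..b, (4*phi1 (s-x0) + V s) * v s) =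
      4*(∫ s in a..b, phi1 (s-x0) * v s) + (∫ s in a..b, V s * v s) := by
    rw [← intervalIntegral.integral_const_mul,
      ← intervalIntegral.integral_add ((mv _ (cI _ hP1)).const_mul 4) (mv _ hVi)]
    congr 1; funext s; ring
  have e4 : (∫ s in a..b, Ks s * σ s) = -2*phi2 (b-a) + 4 * ∫ s in a..b, phi1 (s-x0) * σ s := by
    simp only [hσ]
    rw [sg_split ha hb Ks (fun p q => hKsc.intervalIntegrable p q),
      sg_split ha hb (fun s => phi1 (s-x0)) (fun p q => hP1.intervalIntegrable p q)]
    have g : ∀ p q, ∫ s in p..q, Ks s = -(phi2 (q-b) - phi2 (p-b)) - (phi2 (q-a) - phi2 (p-a))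
        + 2*(phi2 (q-x0) - phi2 (p-x0)) := by
      intro p q
      have i : ∀ y, IntervalIntegrable (fun s => phi1 (s-y)) volume p q := fun y =>
        (phi1_cont.comp (by fun_prop)).intervalIntegrable _ _
      have ib : IntervalIntegrable (fun s => -phi1 (s-b)) volume p q := (i b).neg
      rw [← int_phi1, ← int_phi1, ← int_phi1, ← intervalIntegral.integral_neg,
        ← intervalIntegral.integral_sub ib (i a), ← intervalIntegral.integral_const_mul,
        ← intervalIntegral.integral_add (ib.sub (i a)) ((i x0).const_mul 2)]
    rw [g, g, int_phi1, int_phi1]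
    have z : phi2 0 = 0 := by simp [phi2]
    have n1 : phi2 (a-b) = phi2 (b-a) := by rw [← phi2_neg]; congr 1; ring
    have n2 : phi2 (x0-b) = phi2 (b-x0) := by rw [← phi2_neg]; congr 1; ring
    have n3 : phi2 (a-x0) = phi2 (x0-a) := by rw [← phi2_neg]; congr 1; ring
    simp only [sub_self, z, n1, n2, n3]
    ring
  -- assemble
  have hFi : Integrable (fun s => 2*phi1 (s-x0) + V s) μ :=
    (cI _ (continuous_const.mul hP1)).add hVi
  constructor
  · have := (ms _ hFi).add (mv _ hFi)
    refine this.congr ?_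
    intro s _
    simp only; ring
  · have hin' : (fun s => (∫ t in a..b, phi0 (s-t) * (sg (t-x0) + v t)) * (sg (s-x0) + v s))
        = fun s => (Ks s + V s) * (σ s + v s) := by
      funext s; rw [← hin]
    rw [hin', e1, e2, e3, e4, hF]
    have e5 : ∫ s in a..b, Ks s * v s = ∫ s in a..b, V s * σ s := hF.symm
    ring

lemma int_cos_k (k : ℤ) : ∫ ψ in (0:ℝ)..π, Real.cos (k*ψ) = if k = 0 then π else 0 := by
  split_ifs with h
  · subst h; simp
  · have hk : (k:ℝ) ≠ 0 := by exact_mod_cast h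
    rw [intervalIntegral.integral_comp_mul_left _ hk]
    simp

lemma int_sin_sin (m n : ℕ) (hn : n ≠ 0) :
    ∫ ψ in (0:ℝ)..π, Real.sin (m*ψ) * Real.sin (n*ψ) = if m = n then π/2 else 0 := by
  have e : ∀ ψ : ℝ, Real.sin (m*ψ) * Real.sin (n*ψ) =
      (1/2) * Real.cos (((m:ℤ)-(n:ℤ) : ℤ)*ψ) - (1/2) * Real.cos (((m:ℤ)+(n:ℤ) : ℤ)*ψ) := by
    intro ψ
    push_cast
    rw [sub_mul, add_mul, Real.cos_sub, Real.cos_add]; ring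
  simp only [e]
  rw [intervalIntegral.integral_sub (by apply Continuous.intervalIntegrable; fun_prop)
    (by apply Continuous.intervalIntegrable; fun_prop), intervalIntegral.integral_const_mul,
    intervalIntegral.integral_const_mul, int_cos_k, int_cos_k]
  have h1 : ((m:ℤ)+(n:ℤ)) ≠ 0 := by omega
  have h2 : ((m:ℤ)-(n:ℤ) = 0) ↔ m = n := by omega
  simp only [h1, h2, if_false]
  split_ifs <;> ring

lemma lem_S (β : ℕ → ℝ) (h0 : β 0 = 0) (hβ : Summable fun m => |β m|) (g : ℝ → ℝ)
    (hg : ∀ ψ, HasSum (fun m : ℕ => β m * Real.sin (m*ψ)) (g ψ)) (n : ℕ) :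
    ∫ ψ in (0:ℝ)..π, g ψ * Real.sin (n*ψ) = π/2 * β n := by
  rcases eq_or_ne n 0 with rfl | hn
  · simp [h0]
  have h := intervalIntegral.hasSum_integral_of_dominated_convergence (μ := volume) (a := 0) (b := π)
    (F := fun (m : ℕ) ψ => β m * Real.sin (m*ψ) * Real.sin (n*ψ))
    (f := fun ψ => g ψ * Real.sin (n*ψ)) (fun m _ => |β m|)
    (fun m => (by fun_prop : Continuous fun ψ : ℝ => β m * Real.sin (m*ψ) * Real.sin (n*ψ)).aestronglyMeasurable)
    (fun m => Filter.Eventually.of_forall fun ψ _ => by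
      rw [Real.norm_eq_abs, abs_mul, abs_mul]
      have a1 := Real.abs_sin_le_one (m*ψ)
      have a2 := Real.abs_sin_le_one (n*ψ)
      calc |β m| * |Real.sin (m*ψ)| * |Real.sin (n*ψ)| ≤ |β m| * 1 * 1 := by gcongr
        _ = |β m| := by ring)
    (Filter.Eventually.of_forall fun ψ _ => hβ)
    (by simp)
    (Filter.Eventually.of_forall fun ψ _ => (hg ψ).mul_right _)
  have e : ∀ m : ℕ, ∫ ψ in (0:ℝ)..π, β m * Real.sin (m*ψ) * Real.sin (n*ψ)
      = if m = n then π/2 * β n else 0 := by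
    intro m
    simp only [mul_assoc]
    rw [intervalIntegral.integral_const_mul, int_sin_sin m n hn]
    split_ifs with hm
    · subst hm; ring
    · ring
  simp only [e] at h
  have h' : HasSum (fun m => if m = n then π/2 * β n else 0) (π/2*β n) := hasSum_ite_eq n _
  exact h.unique h'

def aj (r : ℝ) (j : ℕ) : ℝ := (-1)^(j+1) * r^j / j

def UU (r ψ : ℝ) : ℂ := Complex.log (1 + r * Complex.exp (ψ * Complex.I))

lemma norm_rexp (r ψ : ℝ) (hr : 0 ≤ r) : ‖(r:ℂ) * Complex.exp (ψ * Complex.I)‖ = r := by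
  rw [norm_mul, Complex.norm_exp_ofReal_mul_I]; simp [abs_of_nonneg hr]

lemma UU_hasSum {r : ℝ} (hr : 0 ≤ r) (hr1 : r < 1) (ψ : ℝ) :
    HasSum (fun j : ℕ => (aj r j : ℂ) * Complex.exp (ψ * Complex.I)^j) (UU r ψ) := by
  have h := Complex.hasSum_taylorSeries_log (z := (r:ℂ) * Complex.exp (ψ * Complex.I))
    (by rw [norm_rexp r ψ hr]; exact hr1)
  refine h.congr_fun ?_ |> id
  intro j
  simp only [aj]; push_cast; rw [mul_pow]; ring

lemma exp_pow (ψ : ℝ) (j : ℕ) : Complex.exp (ψ * Complex.I)^j =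
    (Real.cos (j*ψ) : ℂ) + (Real.sin (j*ψ) : ℂ) * Complex.I := by
  rw [← Complex.exp_nat_mul, Complex.ofReal_cos, Complex.ofReal_sin, ← Complex.exp_mul_I]
  congr 1; push_cast; ring

lemma exp_pow_re (ψ : ℝ) (j : ℕ) : (Complex.exp (ψ * Complex.I)^j).re = Real.cos (j*ψ) := by
  rw [exp_pow, Complex.add_re, Complex.re_ofReal_mul, Complex.ofReal_re]; simp

lemma exp_pow_im (ψ : ℝ) (j : ℕ) : (Complex.exp (ψ * Complex.I)^j).im = Real.sin (j*ψ) := by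
  rw [exp_pow, Complex.add_im, Complex.im_ofReal_mul, Complex.ofReal_im]; simp

lemma aj_summable {r : ℝ} (hr : 0 ≤ r) (hr1 : r < 1) : Summable fun m => |aj r m| := by
  refine Summable.of_nonneg_of_le (fun _ => abs_nonneg _) ?_ (summable_geometric_of_lt_one hr hr1)
  intro j
  unfold aj
  rw [abs_div, abs_mul, abs_pow, abs_pow, abs_neg, abs_one, one_pow, one_mul, abs_of_nonneg hr]
  rcases Nat.eq_zero_or_pos j with rfl | hj
  · simp
  · apply div_le_self (by positivity)
    rw [Nat.abs_cast]; exact_mod_cast hj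

lemma UU_im_hasSum {r : ℝ} (hr : 0 ≤ r) (hr1 : r < 1) (ψ : ℝ) :
    HasSum (fun j : ℕ => aj r j * Real.sin (j*ψ)) (UU r ψ).im := by
  have h := Complex.hasSum_im (UU_hasSum hr hr1 ψ)
  refine h.congr_fun ?_ |> id
  intro j
  rw [Complex.im_ofReal_mul, exp_pow_im]

lemma UU_int {r : ℝ} (hr : 0 ≤ r) (hr1 : r < 1) (n : ℕ) :
    ∫ ψ in (0:ℝ)..π, (UU r ψ).im * Real.sin (n*ψ) = π/2 * aj r n :=
  lem_S (aj r) (by simp [aj]) (aj_summable hr hr1) _ (UU_im_hasSum hr hr1) n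

lemma UU_cont {r : ℝ} (hr : 0 ≤ r) (hr1 : r < 1) : Continuous (UU r) := by
  unfold UU
  rw [continuous_iff_continuousAt]
  intro ψ
  apply ContinuousAt.clog (by fun_prop)
  left
  have := Complex.abs_re_le_norm ((r:ℂ) * Complex.exp (ψ * Complex.I))
  rw [norm_rexp r ψ hr] at this
  have := (abs_le.1 this).1
  rw [Complex.add_re, Complex.one_re]; linarith

lemma UU_int_cos {r : ℝ} (hr : 0 ≤ r) (hr1 : r < 1) (m : ℕ) (hm : 1 ≤ m) :
    ∫ ψ in (0:ℝ)..π, (UU r ψ).im * Real.sin ψ * Real.cos (m*ψ) = π/4 * (aj r (m+1) - aj r (m-1)) := by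
  have hc : Continuous fun ψ => (UU r ψ).im := Complex.continuous_im.comp (UU_cont hr hr1)
  have e : ∀ ψ : ℝ, (UU r ψ).im * Real.sin ψ * Real.cos (m*ψ) =
      (1/2) * ((UU r ψ).im * Real.sin ((m+1:ℕ)*ψ)) - (1/2) * ((UU r ψ).im * Real.sin ((m-1:ℕ)*ψ)) := by
    intro ψ
    push_cast [Nat.cast_sub hm]
    rw [sub_mul, add_mul, Real.sin_sub, Real.sin_add, one_mul]; ring
  simp only [e]
  rw [intervalIntegral.integral_sub (by apply Continuous.intervalIntegrable; fun_prop)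
    (by apply Continuous.intervalIntegrable; fun_prop), intervalIntegral.integral_const_mul,
    intervalIntegral.integral_const_mul, UU_int hr hr1, UU_int hr hr1]
  ring

lemma log_pair_hasSum {ρ : ℂ} (hρ : ‖ρ‖ < 1) (ψ : ℝ) :
    HasSum (fun m : ℕ => -(2 * (ρ^m).re / m * Real.cos (m*ψ)))
      (Real.log ‖1 - ρ * Complex.exp (ψ * Complex.I)‖
        + Real.log ‖1 - ρ * Complex.exp (-ψ * Complex.I)‖) := by
  have n1 : ∀ x : ℝ, ‖ρ * Complex.exp (x * Complex.I)‖ < 1 := by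
    intro x; rw [norm_mul, Complex.norm_exp_ofReal_mul_I]; simpa using hρ
  have h1 := Complex.hasSum_re (Complex.hasSum_taylorSeries_neg_log (n1 ψ))
  have h2 := Complex.hasSum_re (Complex.hasSum_taylorSeries_neg_log (n1 (-ψ)))
  have h := (h1.add h2).neg
  simp only [Complex.neg_re, Complex.log_re, neg_add, neg_neg] at h
  push_cast at h
  refine h.congr_fun ?_ |> id
  intro m
  have e2 := exp_pow_re (-ψ) m
  have e3 := exp_pow_im (-ψ) m
  push_cast at e2 e3
  rw [mul_pow, mul_pow]
  have : ∀ w : ℂ, (w / (m:ℂ)).re = w.re / m := by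
    intro w; rw [← Complex.ofReal_natCast, Complex.div_ofReal_re]
  rw [this, this, Complex.mul_re, Complex.mul_re, exp_pow_re, exp_pow_im, e2, e3]
  simp only [mul_neg, Real.cos_neg, Real.sin_neg]
  ring

def EE (r : ℝ) (ρ : ℂ) : ℂ :=
  r + ρ - (r + 1/r + ρ + 1/ρ) * Complex.log (1 + r * ρ)

lemma EE_hasSum {r : ℝ} (hr : 0 < r) (hr1 : r < 1) {ρ : ℂ} (hρ : ‖ρ‖ < 1) (h0 : ρ ≠ 0) :
    HasSum (fun m : ℕ => ρ^m / m * ((aj r (m+1) : ℂ) - (aj r (m-1) : ℂ))) (EE r ρ) := by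
  set y : ℂ := r * ρ with hy
  have hy1 : ‖y‖ < 1 := by
    rw [hy, norm_mul, Complex.norm_real, Real.norm_eq_abs, abs_of_pos hr]
    nlinarith [norm_nonneg ρ]
  have hrc : (r:ℂ) ≠ 0 := by exact_mod_cast hr.ne'
  have hy0 : y ≠ 0 := mul_ne_zero hrc h0
  set l : ℕ → ℂ := fun n => (-1)^(n+1) * y^n / n with hl
  have H : HasSum l (Complex.log (1+y)) := Complex.hasSum_taylorSeries_log hy1
  have H1 : HasSum (fun n => l (n+1)) (Complex.log (1+y)) := by
    rw [hasSum_nat_add_iff]; simpa [hl] using H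
  have H2 : HasSum (fun n => l (n+2)) (Complex.log (1+y) - y) := by
    rw [hasSum_nat_add_iff]; simpa [hl, Finset.sum_range_succ] using H
  have H3 : HasSum (fun n => l (n+3)) (Complex.log (1+y) - y + y^2/2) := by
    rw [hasSum_nat_add_iff]
    have e : Complex.log (1+y) - y + y^2/2 + ∑ i ∈ Finset.range 3, l i = Complex.log (1+y) := by
      simp [hl, Finset.sum_range_succ]; ring
    rw [e]; exact H
  rw [← hasSum_nat_add_iff' 2]
  have K := ((H2.neg.sub (H3.mul_right (1/y))).mul_left (r:ℂ)).sub
    (((H1.mul_left y).add H2).mul_left (1/(r:ℂ)))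
  convert K using 1
  · funext n
    have n1 : (n:ℂ)+1 ≠ 0 := by exact_mod_cast (Nat.succ_ne_zero n)
    have n2 : (n:ℂ)+2 ≠ 0 := by exact_mod_cast (Nat.succ_ne_zero (n+1))
    have n3 : (n:ℂ)+3 ≠ 0 := by exact_mod_cast (Nat.succ_ne_zero (n+2))
    have n3' : (n:ℂ)+2+1 ≠ 0 := by exact_mod_cast (Nat.succ_ne_zero (n+2))
    simp only [aj, hl, hy, show n+2-1 = n+1 from rfl]
    push_cast
    have n3'' : (n:ℂ)+2+1 = n+3 := by ring
    rw [n3'']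
    field_simp
    ring
  · simp [Finset.sum_range_succ, aj, EE]
    rw [hy]
    field_simp
    ring

lemma W_series {r : ℝ} (hr : 0 < r) (hr1 : r < 1) {ρ : ℂ} (hρ : ‖ρ‖ < 1) (h0 : ρ ≠ 0) :
    ∫ ψ in (0:ℝ)..π, (UU r ψ).im * Real.sin ψ *
      (Real.log ‖1 - ρ * Complex.exp (ψ * Complex.I)‖
        + Real.log ‖1 - ρ * Complex.exp (-ψ * Complex.I)‖) = -(π/2) * (EE r ρ).re := by
  have hc : Continuous fun ψ => (UU r ψ).im := Complex.continuous_im.comp (UU_cont hr.le hr1)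
  have ub : ∀ ψ, |(UU r ψ).im| ≤ π := fun ψ => by
    unfold UU; rw [Complex.log_im]; exact Complex.abs_arg_le_pi _
  have sρ : Summable fun m : ℕ => π * (2 * ‖ρ‖^m) :=
    ((summable_geometric_of_lt_one (norm_nonneg _) hρ).mul_left 2).mul_left π
  have h := intervalIntegral.hasSum_integral_of_dominated_convergence (μ := volume) (a := 0) (b := π)
    (F := fun (m : ℕ) ψ => (UU r ψ).im * Real.sin ψ * (-(2 * (ρ^m).re / m * Real.cos (m*ψ))))
    (f := fun ψ => (UU r ψ).im * Real.sin ψ *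
      (Real.log ‖1 - ρ * Complex.exp (ψ * Complex.I)‖
        + Real.log ‖1 - ρ * Complex.exp (-ψ * Complex.I)‖)) (fun m _ => π * (2 * ‖ρ‖^m))
    (fun m => Continuous.aestronglyMeasurable (by fun_prop))
    (fun m => Filter.Eventually.of_forall fun ψ _ => by
      rw [Real.norm_eq_abs, abs_mul, abs_mul, abs_neg, abs_mul, abs_div, abs_mul]
      have a1 := Real.abs_sin_le_one ψ
      have a2 := Real.abs_cos_le_one (m*ψ)
      have a3 : |(ρ^m).re| ≤ ‖ρ‖^m := by rw [← norm_pow]; exact Complex.abs_re_le_norm _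
      have a4 : |(2:ℝ)| * |(ρ^m).re| / |(m:ℝ)| ≤ 2 * ‖ρ‖^m := by
        rcases Nat.eq_zero_or_pos m with rfl | hm
        · simp
        · rw [abs_of_pos (by norm_num : (0:ℝ) < 2), Nat.abs_cast]
          apply (div_le_self (by positivity) (by exact_mod_cast hm)).trans
          linarith
      calc _ ≤ π * 1 * ((2 * ‖ρ‖^m) * 1) := by
            gcongr
            exact ub ψ
        _ = _ := by ring)
    (Filter.Eventually.of_forall fun ψ _ => sρ)
    (by simp)
    (Filter.Eventually.of_forall fun ψ _ => (log_pair_hasSum hρ ψ).mul_left _)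
  have h2 := (Complex.hasSum_re (EE_hasSum hr hr1 hρ h0)).mul_left (-(π/2))
  refine h.unique ?_
  refine h2.congr_fun ?_ |> id
  intro m
  rcases Nat.eq_zero_or_pos m with rfl | hm
  · simp
  have e : ∀ ψ : ℝ, (UU r ψ).im * Real.sin ψ * (-(2 * (ρ^m).re / m * Real.cos (m*ψ))) =
    (-(2 * (ρ^m).re / m)) * ((UU r ψ).im * Real.sin ψ * Real.cos (m*ψ)) := by intro ψ; ring
  simp only [e]
  rw [intervalIntegral.integral_const_mul, UU_int_cos hr.le hr1 m hm]
  have : (ρ^m / m * ((aj r (m+1) : ℂ) - (aj r (m-1) : ℂ))).re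
      = (ρ^m).re / m * (aj r (m+1) - aj r (m-1)) := by
    rw [← Complex.ofReal_sub, Complex.re_mul_ofReal, ← Complex.ofReal_natCast, Complex.div_ofReal_re]
  rw [this]; ring

lemma lim1 {f : ℝ → ℝ} {l : ℝ} (hc : ContinuousAt f 1) (h : f 1 = l) :
    Tendsto f (𝓝[<] 1) (𝓝 l) := by
  rw [← h]; exact hc.tendsto.mono_left nhdsWithin_le_nhds

lemma Z_aux {r : ℝ} (hr : 0 ≤ r) (hr1 : r < 1) (n : ℕ) :
    ∫ ψ in (0:ℝ)..π, ((UU r ψ)^2).im * Real.sin (n*ψ) =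
      π/2 * ∑ p ∈ Finset.HasAntidiagonal.antidiagonal n, aj r p.1 * aj r p.2 := by
  have hs := aj_summable hr hr1
  refine lem_S (fun n => ∑ p ∈ Finset.HasAntidiagonal.antidiagonal n, aj r p.1 * aj r p.2) (by simp [aj]) ?_
    (fun ψ => ((UU r ψ)^2).im) ?_ n
  · exact summable_norm_sum_mul_antidiagonal_of_summable_norm (f := aj r) (g := aj r) hs hs
  · intro ψ
    set ζ := Complex.exp (ψ * Complex.I) with hζ
    have hz : ‖ζ‖ = 1 := Complex.norm_exp_ofReal_mul_I ψ
    have hf : Summable fun j => ‖(aj r j : ℂ) * ζ^j‖ := by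
      simpa [norm_mul, norm_pow, hz] using hs
    have h1 := tsum_mul_tsum_eq_tsum_sum_antidiagonal_of_summable_norm hf hf
    have h2 := (summable_norm_sum_mul_antidiagonal_of_summable_norm hf hf).of_norm.hasSum
    rw [← h1, (UU_hasSum hr hr1 ψ).tsum_eq, ← sq] at h2
    have h3 := Complex.hasSum_im h2
    refine h3.congr_fun ?_ |> id
    intro n
    have : ∑ p ∈ Finset.HasAntidiagonal.antidiagonal n, (aj r p.1 : ℂ) * ζ^p.1 * ((aj r p.2 : ℂ) * ζ^p.2)
        = ((∑ p ∈ Finset.HasAntidiagonal.antidiagonal n, aj r p.1 * aj r p.2 : ℝ) : ℂ) * ζ^n := by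
      push_cast
      rw [Finset.sum_mul]
      apply Finset.sum_congr rfl
      intro p hp
      rw [← Finset.HasAntidiagonal.mem_antidiagonal.1 hp, pow_add]; ring
    rw [this, Complex.im_ofReal_mul, hζ, exp_pow_im]

lemma UU_sq_im (r ψ : ℝ) : ((UU r ψ)^2).im =
    2 * ((UU r ψ).im * Real.log ‖1 + r * Complex.exp (ψ * Complex.I)‖) := by
  rw [sq, Complex.mul_im]
  have : (UU r ψ).re = Real.log ‖1 + r * Complex.exp (ψ * Complex.I)‖ := by
    unfold UU; rw [Complex.log_re]
  rw [this]; ring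

lemma Z1_series {r : ℝ} (hr : 0 ≤ r) (hr1 : r < 1) :
    ∫ ψ in (0:ℝ)..π, (UU r ψ).im * Real.sin ψ *
      Real.log ‖1 + r * Complex.exp (ψ * Complex.I)‖ = 0 := by
  have h := Z_aux hr hr1 1
  have e : ∀ ψ : ℝ, (UU r ψ).im * Real.sin ψ * Real.log ‖1 + r * Complex.exp (ψ * Complex.I)‖
      = (1/2) * (((UU r ψ)^2).im * Real.sin ((1:ℕ)*ψ)) := by
    intro ψ; rw [UU_sq_im]; push_cast; rw [one_mul]; ring
  simp only [e]
  rw [intervalIntegral.integral_const_mul, h]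
  simp [aj, Finset.Nat.antidiagonal_succ]

lemma Z2_series {r : ℝ} (hr : 0 ≤ r) (hr1 : r < 1) :
    ∫ ψ in (0:ℝ)..π, (UU r ψ).im * (Real.sin ψ * Real.cos ψ) *
      Real.log ‖1 + r * Complex.exp (ψ * Complex.I)‖ = π*r^2/8 := by
  have h := Z_aux hr hr1 2
  have e : ∀ ψ : ℝ, (UU r ψ).im * (Real.sin ψ * Real.cos ψ) *
      Real.log ‖1 + r * Complex.exp (ψ * Complex.I)‖
      = (1/4) * (((UU r ψ)^2).im * Real.sin ((2:ℕ)*ψ)) := by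
    intro ψ; rw [UU_sq_im]; push_cast; rw [Real.sin_two_mul]; ring
  simp only [e]
  rw [intervalIntegral.integral_const_mul, h]
  simp [aj, Finset.Nat.antidiagonal_succ]
  ring

lemma log_bound {η : ℂ} (hη : ‖η‖ ≤ 1) (h1 : 1 - η ≠ 0) {t : ℝ} (ht0 : 0 ≤ t) (ht : t < 1) :
    |Real.log ‖1 - t * η‖| ≤ Real.log 2 + |Real.log ‖1 - η‖| := by
  have hp : 0 < ‖1 - η‖ := norm_pos_iff.2 h1
  have hn : ‖(t:ℂ) * η‖ ≤ t := by
    rw [norm_mul, Complex.norm_real, Real.norm_eq_abs, abs_of_nonneg ht0]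
    nlinarith
  have hu : ‖1 - t * η‖ ≤ 2 := by
    calc ‖1 - t * η‖ ≤ ‖(1:ℂ)‖ + ‖(t:ℂ) * η‖ := norm_sub_le _ _
      _ ≤ 2 := by rw [norm_one]; linarith
  have hl : 1 - t ≤ ‖1 - t * η‖ := by
    have := norm_sub_norm_le (1:ℂ) (t * η)
    rw [norm_one] at this; linarith
  have hm : ‖1 - η‖ ≤ 2 * ‖1 - t * η‖ := by
    have e : 1 - η = (1 - t * η) - ((1 - t : ℝ) : ℂ) * η := by push_cast; ring
    have h3 : ‖((1 - t : ℝ) : ℂ) * η‖ ≤ 1 - t := by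
      rw [norm_mul, Complex.norm_real, Real.norm_eq_abs, abs_of_nonneg (by linarith)]
      nlinarith
    calc ‖1 - η‖ = ‖(1 - t * η) - ((1 - t : ℝ) : ℂ) * η‖ := by rw [← e]
      _ ≤ ‖1 - t * η‖ + ‖((1 - t : ℝ) : ℂ) * η‖ := norm_sub_le _ _
      _ ≤ _ := by linarith
  have hpos : 0 < ‖1 - t * η‖ := by linarith
  have l2 : 0 ≤ Real.log 2 := Real.log_nonneg (by norm_num)
  rw [abs_le]
  constructor
  · have := Real.log_le_log hp hm
    rw [Real.log_mul (by norm_num) hpos.ne'] at this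
    have := neg_abs_le (Real.log ‖1 - η‖)
    linarith
  · have := Real.log_le_log hpos hu
    have := abs_nonneg (Real.log ‖1 - η‖)
    linarith

lemma log_circ_int (ρ : ℂ) :
    IntervalIntegrable (fun ψ : ℝ => Real.log ‖1 - ρ * Complex.exp (ψ * Complex.I)‖) volume 0 π := by
  have h : CircleIntegrable (fun z : ℂ => Real.log ‖1 - ρ * z‖) 0 1 :=
    MeromorphicOn.circleIntegrable_log_norm (f := fun z => 1 - ρ * z) (fun z hz => by fun_prop)
  unfold CircleIntegrable at h
  simp only [circleMap, Complex.ofReal_one, one_mul, zero_add] at h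
  apply h.mono_set
  rw [Set.uIcc_of_le Real.pi_pos.le, Set.uIcc_of_le (by linarith [Real.pi_pos])]
  exact Set.Icc_subset_Icc_right (by linarith [Real.pi_pos])

lemma UU_meas (r : ℝ) : Measurable (UU r) := by
  unfold UU
  exact Complex.measurable_log.comp (by fun_prop)

lemma UU_im_le (r ψ : ℝ) : |(UU r ψ).im| ≤ π := by
  unfold UU; rw [Complex.log_im]; exact Complex.abs_arg_le_pi _

lemma bad_null (ρ : ℂ) : ∀ᵐ ψ : ℝ, Complex.exp (ψ * Complex.I) ≠ ρ := by
  have h : ({ρ} : Set ℂ).Countable := Set.countable_singleton ρ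
  have h2 := (h.preimage_circleMap 0 (R := 1) one_ne_zero).ae_notMem volume
  filter_upwards [h2] with ψ hψ h3
  apply hψ
  simp [circleMap, h3]

lemma slit {r : ℝ} (hr : 0 ≤ r) (hr1 : r ≤ 1) {ζ : ℂ} (hz : ‖ζ‖ ≤ 1) (hm : 1 + r * ζ ≠ 0) :
    1 + r * ζ ∈ Complex.slitPlane := by
  have hn : ‖(r:ℂ) * ζ‖ ≤ 1 := by
    rw [norm_mul, Complex.norm_real, Real.norm_eq_abs, abs_of_nonneg hr]
    nlinarith [norm_nonneg ζ]
  set w := (r:ℂ) * ζ with hw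
  by_contra hns
  rw [Complex.mem_slitPlane_iff] at hns
  push Not at hns
  obtain ⟨h1, h2⟩ := hns
  simp at h1 h2
  apply hm
  have h3 := (abs_le.1 ((Complex.abs_re_le_norm w).trans hn)).1
  apply Complex.ext
  · simp; linarith
  · simp [h2]

lemma lim_lem {r : ℝ} (hr : 0 ≤ r) (hr1 : r ≤ 1) {ρ ρ' : ℂ} (hρ : ‖ρ‖ ≤ 1) (hρ' : ‖ρ'‖ ≤ 1)
    (p : ℝ → ℝ) (hp : Continuous p) (hp1 : ∀ ψ, |p ψ| ≤ 1) :
    Tendsto (fun t : ℝ => ∫ ψ in (0:ℝ)..π, (UU (t*r) ψ).im * p ψ *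
      (Real.log ‖1 - t * ρ * Complex.exp (ψ * Complex.I)‖
        + Real.log ‖1 - t * ρ' * Complex.exp (ψ * Complex.I)‖)) (𝓝[<] 1)
      (𝓝 (∫ ψ in (0:ℝ)..π, (UU r ψ).im * p ψ *
      (Real.log ‖1 - ρ * Complex.exp (ψ * Complex.I)‖
        + Real.log ‖1 - ρ' * Complex.exp (ψ * Complex.I)‖))) := by
  have ht : ∀ᶠ t : ℝ in 𝓝[<] 1, 0 < t ∧ t < 1 := by
    have : Set.Ioo (0:ℝ) 1 ∈ 𝓝[<] (1:ℝ) := Ioo_mem_nhdsLT (by norm_num)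
    filter_upwards [this] with t h using h
  have good : ∀ q : ℂ, ∀ᵐ ψ : ℝ, 1 - q * Complex.exp (ψ * Complex.I) ≠ 0 := by
    intro q
    filter_upwards [bad_null (q⁻¹)] with ψ h h2
    apply h
    have hq : q ≠ 0 := by rintro rfl; simp at h2
    field_simp
    linear_combination -h2
  have nn : ∀ q : ℂ, ‖q‖ ≤ 1 → ∀ ψ : ℝ, ‖q * Complex.exp (ψ * Complex.I)‖ ≤ 1 := by
    intro q hq ψ; rw [norm_mul, Complex.norm_exp_ofReal_mul_I]; simpa using hq
  apply intervalIntegral.tendsto_integral_filter_of_dominated_convergence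
    (fun ψ => π * ((Real.log 2 + |Real.log ‖1 - ρ * Complex.exp (ψ * Complex.I)‖|) +
      (Real.log 2 + |Real.log ‖1 - ρ' * Complex.exp (ψ * Complex.I)‖|)))
  · refine Filter.Eventually.of_forall fun t => ?_
    apply Measurable.aestronglyMeasurable
    have h1 := Complex.measurable_im.comp (UU_meas (t*r))
    have h2 : ∀ q : ℂ, Measurable fun ψ : ℝ => Real.log ‖1 - q * Complex.exp (ψ * Complex.I)‖ :=
      fun q => Real.measurable_log.comp (by fun_prop)
    exact (h1.mul hp.measurable).mul ((h2 _).add (h2 _))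
  · filter_upwards [ht] with t ht
    filter_upwards [good ρ, good ρ'] with ψ g1 g2 _
    rw [Real.norm_eq_abs, abs_mul, abs_mul]
    have b1 := log_bound (nn ρ hρ ψ) g1 ht.1.le ht.2
    have b2 := log_bound (nn ρ' hρ' ψ) g2 ht.1.le ht.2
    rw [← mul_assoc] at b1 b2
    calc _ ≤ π * 1 * ((Real.log 2 + |Real.log ‖1 - ρ * Complex.exp (ψ * Complex.I)‖|) +
      (Real.log 2 + |Real.log ‖1 - ρ' * Complex.exp (ψ * Complex.I)‖|)) := by
          gcongr
          · exact UU_im_le _ _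
          · exact hp1 ψ
          · exact (abs_add_le _ _).trans (add_le_add b1 b2)
      _ = _ := by ring
  · exact (((_root_.intervalIntegrable_const).add (log_circ_int ρ).abs).add
      ((_root_.intervalIntegrable_const).add (log_circ_int ρ').abs)).const_mul π
  · filter_upwards [good ρ, good ρ', good (-(r:ℂ))] with ψ g1 g2 g3 _
    have lg : ∀ q : ℂ, 1 - q * Complex.exp (ψ * Complex.I) ≠ 0 →
        Tendsto (fun t : ℝ => Real.log ‖1 - t * q * Complex.exp (ψ * Complex.I)‖) (𝓝[<] 1)
        (𝓝 (Real.log ‖1 - q * Complex.exp (ψ * Complex.I)‖)) := by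
      intro q hq
      have hc : ContinuousAt (fun t : ℝ => Real.log ‖1 - t * q * Complex.exp (ψ * Complex.I)‖) 1 := by
        apply ContinuousAt.log (by fun_prop)
        simpa using hq
      exact lim1 hc (by simp)
    have hU : Tendsto (fun t : ℝ => (UU (t*r) ψ).im) (𝓝[<] 1) (𝓝 (UU r ψ).im) := by
      have hc : ContinuousAt (fun t : ℝ => (UU (t*r) ψ).im) 1 := by
        unfold UU
        apply Complex.continuous_im.continuousAt.comp
        apply ContinuousAt.clog (by fun_prop)
        rw [one_mul]
        apply slit hr hr1 (Complex.norm_exp_ofReal_mul_I ψ).le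
        intro h; apply g3; linear_combination h
      exact lim1 hc (by simp)
    exact (hU.mul_const _).mul ((lg ρ g1).add (lg ρ' g2))

lemma lim_lem0 {r : ℝ} (hr : 0 ≤ r) (hr1 : r ≤ 1)
    (p : ℝ → ℝ) (hp : Continuous p) (hp1 : ∀ ψ, |p ψ| ≤ 1) :
    Tendsto (fun t : ℝ => ∫ ψ in (0:ℝ)..π, (UU (t*r) ψ).im * p ψ) (𝓝[<] 1)
      (𝓝 (∫ ψ in (0:ℝ)..π, (UU r ψ).im * p ψ)) := by
  apply intervalIntegral.tendsto_integral_filter_of_dominated_convergence (fun ψ => π * 1)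
  · refine Filter.Eventually.of_forall fun t => ?_
    apply Measurable.aestronglyMeasurable
    have h1 := Complex.measurable_im.comp (UU_meas (t*r))
    exact (h1.mul hp.measurable)
  · refine Filter.Eventually.of_forall fun t => Filter.Eventually.of_forall fun ψ _ => ?_
    rw [Real.norm_eq_abs, abs_mul]
    gcongr
    · exact UU_im_le _ _
    · exact hp1 ψ
  · simp
  · filter_upwards [bad_null (-1)] with ψ g3 _
    have hU : Tendsto (fun t : ℝ => (UU (t*r) ψ).im) (𝓝[<] 1) (𝓝 (UU r ψ).im) := by
      have hc : ContinuousAt (fun t : ℝ => (UU (t*r) ψ).im) 1 := by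
        unfold UU
        apply Complex.continuous_im.continuousAt.comp
        apply ContinuousAt.clog (by fun_prop)
        rw [one_mul]
        apply slit hr hr1 (Complex.norm_exp_ofReal_mul_I ψ).le
        intro h; apply g3
        have h2 : (r:ℂ) * Complex.exp (ψ * Complex.I) = -1 := by linear_combination h
        have h3 := congrArg norm h2
        rw [norm_rexp r ψ hr] at h3
        simp at h3
        rw [h3] at h2; simpa using h2
      exact lim1 hc (by simp)
    exact (hU.mul_const _)

lemma tev : ∀ᶠ t : ℝ in 𝓝[<] 1, 0 < t ∧ t < 1 := by
  have : Set.Ioo (0:ℝ) 1 ∈ 𝓝[<] (1:ℝ) := Ioo_mem_nhdsLT (by norm_num)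
  filter_upwards [this] with t h using h

lemma W_final {r : ℝ} (hr : 0 < r) (hr1 : r ≤ 1) {ρ : ℂ} (hρ : ‖ρ‖ ≤ 1) (h0 : ρ ≠ 0)
    (hm : 1 + r * ρ ≠ 0) :
    ∫ ψ in (0:ℝ)..π, (UU r ψ).im * Real.sin ψ *
      (Real.log ‖1 - ρ * Complex.exp (ψ * Complex.I)‖
        + Real.log ‖1 - ρ * Complex.exp (-ψ * Complex.I)‖) = -(π/2) * (EE r ρ).re := by
  have cj : ∀ (q : ℂ) (ψ : ℝ), ‖1 - q * Complex.exp (-ψ * Complex.I)‖ =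
      ‖1 - (starRingEnd ℂ q) * Complex.exp (ψ * Complex.I)‖ := by
    intro q ψ
    rw [← Complex.norm_conj]
    congr 1
    simp [← Complex.exp_conj]
  have h := lim_lem hr.le hr1 hρ (ρ' := starRingEnd ℂ ρ) (by simpa using hρ) Real.sin
    Real.continuous_sin Real.abs_sin_le_one
  simp only [cj]
  refine tendsto_nhds_unique h ?_
  have hE : Tendsto (fun t : ℝ => -(π/2) * (EE (t*r) (t*ρ)).re) (𝓝[<] 1) (𝓝 (-(π/2) * (EE r ρ).re)) := by
    have hrc : (r:ℂ) ≠ 0 := by exact_mod_cast hr.ne'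
    have hc : ContinuousAt (fun t : ℝ => -(π/2) * (EE (t*r) (t*ρ)).re) 1 := by
      apply ContinuousAt.mul continuousAt_const
      apply Complex.continuous_re.continuousAt.comp
      unfold EE
      have hl : ContinuousAt (fun t : ℝ => Complex.log (1 + ((t*r:ℝ):ℂ) * (t*ρ))) 1 := by
        apply ContinuousAt.clog (by fun_prop)
        have := slit hr.le hr1 hρ hm
        simpa using this
      have h1 : ContinuousAt (fun t : ℝ => 1/((t*r:ℝ):ℂ)) 1 := by
        apply ContinuousAt.div continuousAt_const (by fun_prop); simpa using hrc
      have h2 : ContinuousAt (fun t : ℝ => 1/((t:ℂ)*ρ)) 1 := by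
        apply ContinuousAt.div continuousAt_const (by fun_prop); simpa using h0
      have h3 : ContinuousAt (fun t : ℝ => ((t*r:ℝ):ℂ)) 1 := by fun_prop
      have h4 : ContinuousAt (fun t : ℝ => (t:ℂ)*ρ) 1 := by fun_prop
      exact (h3.add h4).sub ((((h3.add h1).add h4).add h2).mul hl)
    exact lim1 hc (by simp)
  refine hE.congr' ?_
  filter_upwards [tev] with t ht
  have hlt : ‖(t:ℂ) * ρ‖ < 1 := by
    rw [norm_mul, Complex.norm_real, Real.norm_eq_abs, abs_of_pos ht.1]
    nlinarith [norm_nonneg ρ]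
  have := W_series (r := t*r) (mul_pos ht.1 hr) (by nlinarith [ht.1, ht.2]) hlt
    (mul_ne_zero (by exact_mod_cast ht.1.ne') h0)
  rw [← this]
  simp only [cj]
  simp

lemma Z1 {r : ℝ} (hr : 0 ≤ r) (hr1 : r ≤ 1) :
    ∫ ψ in (0:ℝ)..π, (UU r ψ).im * Real.sin ψ *
      Real.log ‖1 + r * Complex.exp (ψ * Complex.I)‖ = 0 := by
  have h := lim_lem hr hr1 (ρ := -(r:ℂ)) (ρ' := 0) (by simpa [abs_of_nonneg hr] using hr1) (by simp)
    Real.sin Real.continuous_sin Real.abs_sin_le_one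
  simp only [mul_zero, zero_mul, sub_zero, norm_one, Real.log_one, add_zero, neg_mul,
    sub_neg_eq_add, mul_neg] at h
  refine tendsto_nhds_unique h (tendsto_const_nhds.congr' ?_)
  filter_upwards [tev] with t ht
  have := Z1_series (r := t*r) (mul_nonneg ht.1.le hr) (by nlinarith [ht.1, ht.2])
  push_cast at this
  exact this.symm

lemma Z2 {r : ℝ} (hr : 0 ≤ r) (hr1 : r ≤ 1) :
    ∫ ψ in (0:ℝ)..π, (UU r ψ).im * (Real.sin ψ * Real.cos ψ) *
      Real.log ‖1 + r * Complex.exp (ψ * Complex.I)‖ = π*r^2/8 := by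
  have h := lim_lem hr hr1 (ρ := -(r:ℂ)) (ρ' := 0) (by simpa [abs_of_nonneg hr] using hr1) (by simp)
    (fun ψ => Real.sin ψ * Real.cos ψ) (by fun_prop) (fun ψ => by
      rw [abs_mul]; exact mul_le_one₀ (Real.abs_sin_le_one _) (abs_nonneg _) (Real.abs_cos_le_one _))
  simp only [mul_zero, zero_mul, sub_zero, norm_one, Real.log_one, add_zero, neg_mul,
    sub_neg_eq_add, mul_neg] at h
  have t1 : Tendsto (fun t : ℝ => π*(t*r)^2/8) (𝓝[<] 1) (𝓝 (π*r^2/8)) := by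
    have hc : ContinuousAt (fun t : ℝ => π*(t*r)^2/8) 1 := by fun_prop
    exact lim1 hc (by simp)
  refine tendsto_nhds_unique h (t1.congr' ?_)
  filter_upwards [tev] with t ht
  have := Z2_series (r := t*r) (mul_nonneg ht.1.le hr) (by nlinarith [ht.1, ht.2])
  push_cast at this
  exact this.symm

lemma M1 {r : ℝ} (hr : 0 ≤ r) (hr1 : r ≤ 1) :
    ∫ ψ in (0:ℝ)..π, (UU r ψ).im * Real.sin ψ = π*r/2 := by
  have h := lim_lem0 hr hr1 Real.sin Real.continuous_sin Real.abs_sin_le_one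
  have t1 : Tendsto (fun t : ℝ => π*(t*r)/2) (𝓝[<] 1) (𝓝 (π*r/2)) := by
    have hc : ContinuousAt (fun t : ℝ => π*(t*r)/2) 1 := by fun_prop
    exact lim1 hc (by simp)
  refine tendsto_nhds_unique h (t1.congr' ?_)
  filter_upwards [tev] with t ht
  have := UU_int (r := t*r) (mul_nonneg ht.1.le hr) (by nlinarith [ht.1, ht.2]) 1
  simp [aj] at this
  rw [this]; ring

lemma M2 {r : ℝ} (hr : 0 ≤ r) (hr1 : r ≤ 1) :
    ∫ ψ in (0:ℝ)..π, (UU r ψ).im * (Real.sin ψ * Real.cos ψ) = -(π*r^2/8) := by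
  have h := lim_lem0 hr hr1 (fun ψ => Real.sin ψ * Real.cos ψ) (by fun_prop) (fun ψ => by
      rw [abs_mul]; exact mul_le_one₀ (Real.abs_sin_le_one _) (abs_nonneg _) (Real.abs_cos_le_one _))
  have t1 : Tendsto (fun t : ℝ => -(π*(t*r)^2/8)) (𝓝[<] 1) (𝓝 (-(π*r^2/8))) := by
    have hc : ContinuousAt (fun t : ℝ => -(π*(t*r)^2/8)) 1 := by fun_prop
    exact lim1 hc (by simp)
  refine tendsto_nhds_unique h (t1.congr' ?_)
  filter_upwards [tev] with t ht
  have := UU_int_cos (r := t*r) (mul_nonneg ht.1.le hr) (by nlinarith [ht.1, ht.2]) 1 le_rfl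
  simp only [Nat.cast_one, one_mul] at this
  simp only [← mul_assoc]
  rw [this]; simp [aj]; ring

lemma UU_arg (r ψ : ℝ) : (UU r ψ).im = Complex.arg (1 + r * Complex.exp (ψ * Complex.I)) := by
  unfold UU; rw [Complex.log_im]

lemma cpt_re (r ψ : ℝ) : (1 + r * Complex.exp (ψ * Complex.I)).re = 1 + r * Real.cos ψ := by
  simp [Complex.exp_ofReal_mul_I_re]

lemma cpt_im (r ψ : ℝ) : (1 + r * Complex.exp (ψ * Complex.I)).im = r * Real.sin ψ := by
  simp [Complex.exp_ofReal_mul_I_im]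

lemma Ar_UU {r : ℝ} (hr : 0 ≤ r) (hr1 : r ≤ 1) {ψ : ℝ} (h0 : 0 < ψ) (h1 : ψ < π) :
    Ar r (Real.cos ψ) = (UU r ψ).im := by
  have hs := Real.sin_pos_of_pos_of_lt_pi h0 h1
  have hc : -1 < Real.cos ψ := by
    rw [← Real.cos_pi]; exact Real.cos_lt_cos_of_nonneg_of_le_pi h0.le le_rfl h1
  have hpos : 0 < 1 + r * Real.cos ψ := by
    rcases eq_or_lt_of_le hr with h | h
    · rw [← h]; norm_num
    · nlinarith
  rw [UU_arg]
  set w := 1 + r * Complex.exp (ψ * Complex.I) with hw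
  have hre : w.re = 1 + r * Real.cos ψ := cpt_re r ψ
  have him : w.im = r * Real.sin ψ := cpt_im r ψ
  have ha : |w.arg| < π/2 := by
    rw [Complex.abs_arg_lt_pi_div_two_iff]; left; rw [hre]; exact hpos
  have hsq : Real.sqrt (1 - Real.cos ψ^2) = Real.sin ψ := by
    rw [← Real.sin_sq, Real.sqrt_sq hs.le]
  unfold Ar
  rw [hsq, ← hre, ← him, ← Complex.tan_arg, Real.arctan_tan (abs_lt.1 ha).1 (abs_lt.1 ha).2]

lemma cos_subst (g : ℝ → ℝ) :
    ∫ t in (-1:ℝ)..1, g t = ∫ ψ in (0:ℝ)..π, g (Real.cos ψ) * Real.sin ψ := by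
  rw [intervalIntegral.integral_of_le (by norm_num), intervalIntegral.integral_of_le Real.pi_pos.le,
    MeasureTheory.integral_Ioc_eq_integral_Ioo, MeasureTheory.integral_Ioc_eq_integral_Ioo]
  have inj : Set.InjOn Real.cos (Set.Ioo 0 π) :=
    Real.injOn_cos.mono Set.Ioo_subset_Icc_self
  have im : Real.cos '' Set.Ioo 0 π = Set.Ioo (-1) 1 := by
    ext x
    constructor
    · rintro ⟨ψ, ⟨h0, h1⟩, rfl⟩
      constructor
      · rw [← Real.cos_pi]; exact Real.cos_lt_cos_of_nonneg_of_le_pi h0.le le_rfl h1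
      · rw [← Real.cos_zero]; exact Real.cos_lt_cos_of_nonneg_of_le_pi le_rfl h1.le h0
    · rintro ⟨h0, h1⟩
      refine ⟨Real.arccos x, ⟨Real.arccos_pos.2 h1, ?_⟩, Real.cos_arccos h0.le h1.le⟩
      refine lt_of_le_of_ne (Real.arccos_le_pi x) ?_
      intro h
      rw [Real.arccos_eq_pi] at h; linarith
  rw [← im, MeasureTheory.integral_image_eq_integral_abs_deriv_smul measurableSet_Ioo
    (fun x _ => (Real.hasDerivAt_cos x).hasDerivWithinAt) inj g]
  apply MeasureTheory.setIntegral_congr_fun measurableSet_Ioo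
  intro ψ hψ
  have hs := Real.sin_pos_of_pos_of_lt_pi hψ.1 hψ.2
  simp only [abs_neg, abs_of_pos hs, smul_eq_mul]; ring

lemma Ar_subst {r : ℝ} (hr : 0 ≤ r) (hr1 : r ≤ 1) (g : ℝ → ℝ) :
    ∫ t in (-1:ℝ)..1, g t * Ar r t = ∫ ψ in (0:ℝ)..π, (UU r ψ).im * Real.sin ψ * g (Real.cos ψ) := by
  rw [cos_subst]
  apply intervalIntegral.integral_congr_Ioo_of_le Real.pi_pos.le
  intro ψ hψ
  simp only [Ar_UU hr hr1 hψ.1 hψ.2]; ring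

lemma EE_re (r : ℝ) (ρ : ℂ) (z : ℝ) (h : ρ + 1/ρ = 2*(z:ℂ)) :
    (EE r ρ).re = r + ρ.re - 2*(z + (r+1/r)/2) * Real.log ‖1 + r*ρ‖ := by
  unfold EE
  have e : (r:ℂ) + ρ - (r + 1/r + ρ + 1/ρ) * Complex.log (1 + r*ρ) =
      r + ρ - ((2*(z + (r+1/r)/2) : ℝ) : ℂ) * Complex.log (1 + r*ρ) := by
    push_cast; linear_combination (-Complex.log (1 + r*ρ)) * h
  rw [e]
  rw [Complex.sub_re, Complex.add_re, Complex.re_ofReal_mul, Complex.log_re, Complex.ofReal_re]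

lemma L_formula {r : ℝ} (hr : 0 < r) (hr1 : r ≤ 1) {ρ : ℂ} (hρ : ‖ρ‖ ≤ 1) (h0 : ρ ≠ 0)
    (hm : 1 + r * ρ ≠ 0) {z : ℝ} (hz : ρ + 1/ρ = 2*(z:ℂ)) :
    ∫ t in (-1:ℝ)..1, phi0 (z - t) * Ar r t =
      (π/2) * (r * Real.log ‖ρ‖ + r + ρ.re - 2*(z + (r+1/r)/2) * Real.log ‖1 + r*ρ‖) := by
  rw [Ar_subst hr.le hr1]
  have cj : ∀ (q : ℂ) (ψ : ℝ), ‖1 - q * Complex.exp (-ψ * Complex.I)‖ =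
      ‖1 - (starRingEnd ℂ q) * Complex.exp (ψ * Complex.I)‖ := by
    intro q ψ
    rw [← Complex.norm_conj]
    congr 1
    simp [← Complex.exp_conj]
  have hW := W_final hr hr1 hρ h0 hm
  have hM := M1 hr.le hr1
  have key : ∫ ψ in (0:ℝ)..π, (UU r ψ).im * Real.sin ψ * phi0 (z - Real.cos ψ) =
      ∫ ψ in (0:ℝ)..π, (Real.log ‖ρ‖ * ((UU r ψ).im * Real.sin ψ) -
        (UU r ψ).im * Real.sin ψ *
      (Real.log ‖1 - ρ * Complex.exp (ψ * Complex.I)‖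
        + Real.log ‖1 - ρ * Complex.exp (-ψ * Complex.I)‖)) := by
    apply intervalIntegral.integral_congr_ae
    filter_upwards [bad_null ρ, bad_null ρ⁻¹] with ψ g1 g2 _
    have he : Complex.exp (ψ * Complex.I) * Complex.exp (-ψ * Complex.I) = 1 := by
      rw [← Complex.exp_add]; simp
    have n1 : 1 - ρ * Complex.exp (ψ * Complex.I) ≠ 0 := by
      intro h; apply g2; field_simp; linear_combination -h
    have n2 : 1 - ρ * Complex.exp (-ψ * Complex.I) ≠ 0 := by
      intro h; apply g1
      linear_combination Complex.exp (ψ * Complex.I) * h + ρ * he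
    have hc : (2:ℂ) * Real.cos ψ = Complex.exp (ψ * Complex.I) + Complex.exp (-ψ * Complex.I) := by
      rw [Complex.ofReal_cos]; exact Complex.two_cos _
    have hz2 : ρ * ρ + 1 = 2 * z * ρ := by field_simp at hz; linear_combination hz
    have e : (1 - ρ * Complex.exp (ψ * Complex.I)) * (1 - ρ * Complex.exp (-ψ * Complex.I)) =
        ρ * ((2*(z - Real.cos ψ) : ℝ) : ℂ) := by
      push_cast at hc ⊢
      linear_combination ρ^2 * he + hz2 + ρ * hc
    have e2 := congrArg norm e
    rw [norm_mul, norm_mul, Complex.norm_real, Real.norm_eq_abs] at e2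
    have p0 : ‖ρ‖ ≠ 0 := norm_ne_zero_iff.2 h0
    have p1 := norm_ne_zero_iff.2 n1
    have p2 := norm_ne_zero_iff.2 n2
    have p3 : |2*(z - Real.cos ψ)| ≠ 0 := by
      intro h; rw [h, mul_zero] at e2; exact mul_ne_zero p1 p2 e2
    have e3 := congrArg Real.log e2
    rw [Real.log_mul p1 p2, Real.log_mul p0 p3] at e3
    unfold phi0
    linear_combination (UU r ψ).im * Real.sin ψ * e3
  have bd : ∀ f : ℝ → ℝ, IntervalIntegrable f volume 0 π →
      IntervalIntegrable (fun ψ => (UU r ψ).im * Real.sin ψ * f ψ) volume 0 π := by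
    intro f hf
    rw [intervalIntegrable_iff] at hf ⊢
    refine hf.bdd_mul (c := π * 1) ?_ (Filter.Eventually.of_forall fun ψ => ?_)
    · exact ((Complex.measurable_im.comp (UU_meas r)).mul Real.continuous_sin.measurable).aestronglyMeasurable
    · rw [Real.norm_eq_abs, abs_mul]
      gcongr
      · exact UU_im_le _ _
      · exact Real.abs_sin_le_one _
  rw [key, intervalIntegral.integral_sub, intervalIntegral.integral_const_mul, hW, hM, EE_re r ρ z hz]
  · ring
  · have := (bd (fun _ => Real.log ‖ρ‖) _root_.intervalIntegrable_const)
    refine this.congr_ae ?_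
    exact Filter.Eventually.of_forall fun ψ => by simp; ring
  · apply bd
    simp only [cj]
    exact (log_circ_int _).add (log_circ_int _)

def Lf (r z : ℝ) : ℝ := ∫ t in (-1:ℝ)..1, phi0 (z - t) * Ar r t

lemma Ar_meas (r : ℝ) : Measurable (Ar r) := by
  unfold Ar
  exact Real.measurable_arctan.comp (by fun_prop)

lemma Ar_abs (r z : ℝ) : |Ar r z| ≤ π/2 := by
  unfold Ar
  exact abs_le.2 ⟨(Real.neg_pi_div_two_lt_arctan _).le, (Real.arctan_lt_pi_div_two _).le⟩

lemma Ar_zero {z : ℝ} (r : ℝ) (h : 1 ≤ |z|) : Ar r z = 0 := by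
  unfold Ar
  have : Real.sqrt (1 - z^2) = 0 := Real.sqrt_eq_zero_of_nonpos (by nlinarith [sq_abs z])
  simp [this]

lemma L_on {r : ℝ} (hr : 0 < r) (hr1 : r ≤ 1) {z : ℝ} (h0 : -1 < z) (h1 : z < 1) :
    Lf r z = (π/2) * (r + z - (z + (r+1/r)/2) * Real.log (2*r*(z + (r+1/r)/2))) := by
  set θ := Real.arccos z with hθ
  have hc : Real.cos θ = z := Real.cos_arccos h0.le h1.le
  have hn : ‖Complex.exp (θ * Complex.I)‖ = 1 := Complex.norm_exp_ofReal_mul_I θ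
  have he : Complex.exp (θ * Complex.I) * Complex.exp (-θ * Complex.I) = 1 := by
    rw [← Complex.exp_add]; simp
  have hcc : (2:ℂ) * Real.cos θ = Complex.exp (θ * Complex.I) + Complex.exp (-θ * Complex.I) := by
    rw [Complex.ofReal_cos]; exact Complex.two_cos _
  rw [neg_mul] at he hcc
  have hre : 0 < (1 + r * Complex.exp (θ * Complex.I)).re := by
    rw [cpt_re, hc]; nlinarith
  have hm : 1 + r * Complex.exp (θ * Complex.I) ≠ 0 := by
    intro h; rw [h] at hre; simp at hre
  have h := L_formula hr hr1 (ρ := Complex.exp (θ * Complex.I)) hn.le (Complex.exp_ne_zero _) hm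
    (z := z) (by
      rw [← hc, hcc]; field_simp; linear_combination -he)
  unfold Lf
  rw [h, hn, Real.log_one, Complex.exp_ofReal_mul_I_re, hc]
  have hsq : ‖1 + r * Complex.exp (θ * Complex.I)‖^2 = 2*r*(z + (r+1/r)/2) := by
    rw [Complex.sq_norm, Complex.normSq_apply, cpt_re, cpt_im, hc]
    have := Real.sin_sq_add_cos_sq θ
    rw [hc] at this
    field_simp
    linear_combination r^2 * this
  rw [← hsq, Real.log_pow]
  push_cast; ring

lemma L_off {r : ℝ} (hr : 0 < r) (hr1 : r ≤ 1) {z q : ℝ} (hq0 : q ≠ 0) (hq : |q| < 1)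
    (hz : q + 1/q = 2*z) :
    Lf r z = (π/2) * (r * Real.log |q| + r + q - 2*(z + (r+1/r)/2) * Real.log (1 + r*q)) := by
  have hq' := abs_lt.1 hq
  have hp : 0 < 1 + r * q := by nlinarith
  have h := L_formula hr hr1 (ρ := (q:ℂ)) (by rw [Complex.norm_real]; exact hq.le)
    (by exact_mod_cast hq0) (by exact_mod_cast hp.ne') (z := z) (by exact_mod_cast hz)
  unfold Lf
  rw [h, Complex.norm_real, Complex.ofReal_re, Real.norm_eq_abs]
  have : ‖(1:ℂ) + r * q‖ = 1 + r*q := by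
    have e : (1:ℂ) + r * q = ((1 + r*q : ℝ) : ℂ) := by push_cast; ring
    rw [e, Complex.norm_real, Real.norm_eq_abs, abs_of_pos hp]
  rw [this]

lemma Am1 {r : ℝ} (hr : 0 ≤ r) (hr1 : r ≤ 1) : ∫ t in (-1:ℝ)..1, Ar r t = π*r/2 := by
  have := Ar_subst hr hr1 (fun _ => 1)
  simp only [one_mul, mul_one] at this
  rw [this, M1 hr hr1]

lemma Am2 {r : ℝ} (hr : 0 ≤ r) (hr1 : r ≤ 1) : ∫ t in (-1:ℝ)..1, t * Ar r t = -(π*r^2/8) := by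
  have := Ar_subst hr hr1 (fun t => t)
  rw [this, ← M2 hr hr1]
  simp only [mul_assoc]

lemma band_mul_int (r : ℝ) {a b : ℝ} (f : ℝ → ℝ) (hf : IntervalIntegrable f volume a b) :
    IntervalIntegrable (fun t => f t * Ar r t) volume a b := by
  rw [intervalIntegrable_iff] at hf ⊢
  exact Integrable.mul_bdd (c := π/2) hf (Ar_meas r).aestronglyMeasurable
      (Filter.Eventually.of_forall fun t => Ar_abs _ _)

lemma Uint {r : ℝ} (p : ℝ → ℝ) (hp : Continuous p) :
    IntervalIntegrable (fun ψ => (UU r ψ).im * p ψ *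
      Real.log ‖1 + r * Complex.exp (ψ * Complex.I)‖) volume 0 π := by
  have h1 := log_circ_int (-(r:ℂ))
  simp only [neg_mul, sub_neg_eq_add] at h1
  have h2 := h1.mul_continuousOn (hp.continuousOn)
  rw [intervalIntegrable_iff] at h2 ⊢
  have := Integrable.mul_bdd (c := π) (g := fun ψ => (UU r ψ).im) h2 (Complex.measurable_im.comp (UU_meas r)).aestronglyMeasurable
      (Filter.Eventually.of_forall fun t => UU_im_le _ _)
  refine this.congr (Filter.Eventually.of_forall fun t => ?_)
  simp only; ring

lemma Am3 {r : ℝ} (hr : 0 < r) (hr1 : r ≤ 1) : 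
    ∫ t in (-1:ℝ)..1, ((t + (r+1/r)/2) * Real.log (2*r*(t + (r+1/r)/2))) * Ar r t = π*r^2/4 := by
  rw [Ar_subst hr.le hr1]
  have key : ∀ ψ : ℝ, Real.log (2*r*(Real.cos ψ + (r+1/r)/2)) =
      2 * Real.log ‖1 + r * Complex.exp (ψ * Complex.I)‖ := by
    intro ψ
    have hsq : ‖1 + r * Complex.exp (ψ * Complex.I)‖^2 = 2*r*(Real.cos ψ + (r+1/r)/2) := by
      rw [Complex.sq_norm, Complex.normSq_apply, cpt_re, cpt_im]
      have := Real.sin_sq_add_cos_sq ψ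
      field_simp
      linear_combination r^2 * this
    rw [← hsq, Real.log_pow]
    push_cast; ring
  have e : ∀ ψ : ℝ, (UU r ψ).im * Real.sin ψ * ((Real.cos ψ + (r+1/r)/2) *
      Real.log (2*r*(Real.cos ψ + (r+1/r)/2))) =
      2 * ((UU r ψ).im * (Real.sin ψ * Real.cos ψ) *
      Real.log ‖1 + r * Complex.exp (ψ * Complex.I)‖) + (r+1/r) * ((UU r ψ).im * Real.sin ψ *
      Real.log ‖1 + r * Complex.exp (ψ * Complex.I)‖) := by
    intro ψ; rw [key]; ring
  simp only [e]
  rw [intervalIntegral.integral_add, intervalIntegral.integral_const_mul,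
    intervalIntegral.integral_const_mul, Z1 hr.le hr1, Z2 hr.le hr1]
  · ring
  · exact (Uint _ (by fun_prop)).const_mul _
  · exact (Uint _ (by fun_prop)).const_mul _

lemma xlog_cont {r : ℝ} (hr : 0 < r) :
    Continuous fun t : ℝ => (t + (r+1/r)/2) * Real.log (2*r*(t + (r+1/r)/2)) := by
  have : (fun t : ℝ => (t + (r+1/r)/2) * Real.log (2*r*(t + (r+1/r)/2))) =
      fun t => 1/(2*r) * ((2*r*(t + (r+1/r)/2)) * Real.log (2*r*(t + (r+1/r)/2))) := by
    funext t; field_simp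
  rw [this]
  exact continuous_const.mul (Real.continuous_mul_log.comp (by fun_prop))

lemma f_val {r : ℝ} (hr : 0 < r) (hr1 : r ≤ 1) :
    ∫ z in (-1:ℝ)..1, Lf r z * Ar r z = π^2*r^2/16 := by
  have e : ∫ z in (-1:ℝ)..1, Lf r z * Ar r z = ∫ z in (-1:ℝ)..1,
      ((π/2)*r * Ar r z + (π/2) * (z * Ar r z) -
      (π/2) * (((z + (r+1/r)/2) * Real.log (2*r*(z + (r+1/r)/2))) * Ar r z)) := by
    apply intervalIntegral.integral_congr_Ioo_of_le (by norm_num)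
    intro z hz
    simp only
    rw [L_on hr hr1 hz.1 hz.2]; ring
  have i1 := band_mul_int r (a := -1) (b := 1) (fun _ => (π/2)*r) _root_.intervalIntegrable_const
  have i2 := (band_mul_int r (a := -1) (b := 1) (fun t => t) (continuous_id.intervalIntegrable _ _)).const_mul (π/2)
  have i3 := (band_mul_int r (a := -1) (b := 1) _ ((xlog_cont hr).intervalIntegrable _ _)).const_mul (π/2)
  rw [e, intervalIntegral.integral_sub (i1.add i2) i3, intervalIntegral.integral_add i1 i2,
    intervalIntegral.integral_const_mul, intervalIntegral.integral_const_mul,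
    intervalIntegral.integral_const_mul, Am1 hr.le hr1, Am2 hr.le hr1, Am3 hr hr1]
  ring

lemma phi0_neg (x : ℝ) : phi0 (-x) = phi0 x := by unfold phi0; simp

lemma L_symm (r q : ℝ) : ∫ z in (-1:ℝ)..1, Lf r z * Ar q z = ∫ z in (-1:ℝ)..1, Lf q z * Ar r z := by
  unfold Lf
  simp only [← intervalIntegral.integral_mul_const]
  have hP := phi0_prod_int (a := -1) (b := 1) (by norm_num)
  have h1 : Integrable (fun p : ℝ × ℝ => phi0 (p.1 - p.2) * Ar r p.2 * Ar q p.1)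
      ((volume.restrict (Set.Ioc (-1) 1)).prod (volume.restrict (Set.Ioc (-1) 1))) := by
    refine Integrable.mul_bdd (c := π/2) (Integrable.mul_bdd (c := π/2) hP ?_ ?_) ?_ ?_
    · exact ((Ar_meas r).comp measurable_snd).aestronglyMeasurable
    · exact (Filter.Eventually.of_forall fun t => Ar_abs _ _)
    · exact ((Ar_meas q).comp measurable_fst).aestronglyMeasurable
    · exact (Filter.Eventually.of_forall fun t => Ar_abs _ _)
  simp only [intervalIntegral.integral_of_le (show (-1:ℝ) ≤ 1 by norm_num)]
  rw [MeasureTheory.integral_integral_swap (f := fun s t => phi0 (s - t) * Ar r t * Ar q s) h1]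
  congr 1; funext t; congr 1; funext s
  rw [← phi0_neg (s - t), neg_sub]; ring

lemma Ar_trig {r z : ℝ} (hr : 0 ≤ r) (hr1 : r ≤ 1) (h0 : -1 < z) (h1 : z < 1) :
    0 < 1 + r*z ∧ 0 < 1 + r^2 + 2*r*z ∧
    Real.cos (Ar r z) = (1+r*z)/Real.sqrt (1+r^2+2*r*z) ∧
    Real.sin (Ar r z) = r*Real.sqrt (1-z^2)/Real.sqrt (1+r^2+2*r*z) ∧ 0 ≤ Ar r z ∧ Ar r z < π/2 := by
  have hp : 0 < 1 + r*z := by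
    rcases eq_or_lt_of_le hr with h | h
    · rw [← h]; norm_num
    · nlinarith
  have hR : 0 ≤ 1 - z^2 := by nlinarith
  have hD : 1 + r^2 + 2*r*z = (1+r*z)^2 + r^2*(1-z^2) := by ring
  have hD0 : 0 < 1 + r^2 + 2*r*z := by
    rw [hD]; have := mul_nonneg (sq_nonneg r) hR; positivity
  have hs : Real.sqrt (1 + (r * Real.sqrt (1 - z^2) / (1 + r * z))^2) =
      Real.sqrt (1+r^2+2*r*z) / (1+r*z) := by
    rw [Real.sqrt_eq_iff_mul_self_eq (by positivity) (by positivity)]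
    rw [div_mul_div_comm, Real.mul_self_sqrt hD0.le, div_pow, mul_pow, Real.sq_sqrt hR, hD]
    field_simp
  have hQ : 0 < Real.sqrt (1+r^2+2*r*z) := Real.sqrt_pos.2 hD0
  refine ⟨hp, hD0, ?_, ?_, ?_, Real.arctan_lt_pi_div_two _⟩
  · unfold Ar; rw [Real.cos_arctan, hs]; field_simp
  · unfold Ar; rw [Real.sin_arctan, hs]; field_simp
  · unfold Ar; rw [← Real.arctan_zero]; apply Real.arctan_strictMono.monotone; positivity

lemma asin_z {z : ℝ} (h0 : -1 < z) (h1 : z < 1) : Real.arcsin z = π/2 - 2 * Ar 1 z := by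
  obtain ⟨_, hD, hc, _, hn, hl⟩ := Ar_trig (r := 1) zero_le_one le_rfl h0 h1
  apply Real.arcsin_eq_of_sin_eq
  · rw [Real.sin_pi_div_two_sub, Real.cos_two_mul, hc, div_pow, Real.sq_sqrt hD.le]
    have e : (1:ℝ) + 1^2 + 2*1*z = 2*(1+z) := by ring
    have : 1 + z ≠ 0 := by linarith
    rw [e, one_mul]
    field_simp; ring
  · constructor <;> linarith

lemma asin_le {c z : ℝ} (hc : 0 < c) (hc1 : c ≤ 1) (h0 : -1 < z) (h1 : z < 1) :
    Real.arcsin ((z+c)/Real.sqrt (1+c^2+2*c*z)) = π/2 - 2 * Ar 1 z + Ar c z := by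
  obtain ⟨hp, hD, hcos, hsin, hn, hl⟩ := Ar_trig hc.le hc1 h0 h1
  obtain ⟨_, _, _, _, hn1, hl1⟩ := Ar_trig (r := 1) zero_le_one le_rfl h0 h1
  have hR : 0 ≤ 1 - z^2 := by nlinarith
  have hle : Ar c z ≤ Ar 1 z := by
    unfold Ar
    apply Real.arctan_strictMono.monotone
    rw [div_le_div_iff₀ hp (by linarith)]
    have := Real.sqrt_nonneg (1 - z^2)
    nlinarith [mul_nonneg this (sub_nonneg.2 hc1)]
  apply Real.arcsin_eq_of_sin_eq
  · rw [← asin_z h0 h1, Real.sin_add, Real.sin_arcsin h0.le h1.le, Real.cos_arcsin, hcos, hsin]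
    have := Real.sq_sqrt hR
    rw [← mul_div_assoc, ← mul_div_assoc, ← add_div]
    congr 1
    linear_combination c * this
  · constructor <;> linarith

lemma asin_gt {c z : ℝ} (hc1 : 1 < c) (h0 : -1 < z) (h1 : z < 1) :
    Real.arcsin ((z+c)/Real.sqrt (1+c^2+2*c*z)) = π/2 - Ar (1/c) z := by
  have hc : 0 < c := by linarith
  obtain ⟨hp, hD, hcos, hsin, hn, hl⟩ := Ar_trig (r := 1/c) (by positivity)
    (by rw [div_le_one hc]; exact hc1.le) h0 h1
  apply Real.arcsin_eq_of_sin_eq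
  · rw [Real.sin_pi_div_two_sub, hcos]
    have e : 1+c^2+2*c*z = c^2 * (1+(1/c)^2+2*(1/c)*z) := by field_simp; ring
    rw [e, Real.sqrt_mul (sq_nonneg c), Real.sqrt_sq hc.le]
    have := Real.sqrt_pos.2 hD
    field_simp
    ring
  · constructor <;> linarith

lemma h_deriv {c z : ℝ} (hc : 0 < c) (h0 : -1 < z) (h1 : z < 1) :
    HasDerivAt (hshape c) ((2/π) * Real.arcsin ((z+c)/Real.sqrt (1+c^2+2*c*z))) (z + c/2) := by
  set s := z + c/2 with hs
  set R := Real.sqrt (1-z^2) with hR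
  set Q := Real.sqrt (1+c^2+2*c*z) with hQ
  have hD : 0 < 1+c^2+2*c*z := by nlinarith [sq_nonneg (1-c)]
  have hR0 : 0 < 1 - z^2 := by nlinarith
  have Rp : 0 < R := Real.sqrt_pos.2 hR0
  have Qp : 0 < Q := Real.sqrt_pos.2 hD
  have R2 : R^2 = 1-z^2 := Real.sq_sqrt hR0.le
  have Q2 : Q^2 = 1+c^2+2*c*z := Real.sq_sqrt hD.le
  have eD : 1+2*s*c = 1+c^2+2*c*z := by rw [hs]; ring
  have dD : HasDerivAt (fun s : ℝ => 1+2*s*c) (2*c) s := by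
    have := (((hasDerivAt_id s).const_mul 2).mul_const c).const_add 1
    simpa using this
  have dQ : HasDerivAt (fun s : ℝ => Real.sqrt (1+2*s*c)) (2*c/(2*Q)) s := by
    have := dD.sqrt (by rw [eD]; exact hD.ne')
    rw [eD] at this; exact this
  have d1 : HasDerivAt (fun s : ℝ => 2*s+c) 2 s := by
    simpa using ((hasDerivAt_id s).const_mul 2).add_const c
  have d2 : HasDerivAt (fun s : ℝ => 2+2*s*c-c^2) (2*c) s := by
    simpa using ((((hasDerivAt_id s).const_mul 2).mul_const c).const_add 2).sub_const (c^2)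
  have d3 : HasDerivAt (fun s : ℝ => 4-(2*s-c)^2) (-(4*(2*s-c))) s := by
    have := ((((hasDerivAt_id s).const_mul 2).sub_const c).pow 2).const_sub 4
    convert! this using 1
    simp; ring
  have eQ : Real.sqrt (1+2*s*c) = Q := by rw [eD]
  have eα : (2*s+c)/(2*Real.sqrt (1+2*s*c)) = (z+c)/Q := by
    rw [eQ, hs]; field_simp; ring
  have eβ : (2+2*s*c-c^2)/(2*Real.sqrt (1+2*s*c)) = (1+c*z)/Q := by
    rw [eQ, hs]; field_simp; ring
  have sα : Real.sqrt (1 - ((z+c)/Q)^2) = R/Q := by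
    rw [Real.sqrt_eq_iff_mul_self_eq_of_pos (by positivity)]
    field_simp; rw [R2, Q2]; ring
  have sβ : Real.sqrt (1 - ((1+c*z)/Q)^2) = c*R/Q := by
    rw [Real.sqrt_eq_iff_mul_self_eq_of_pos (by positivity)]
    field_simp; rw [R2, Q2]; ring
  have bα : 0 < 1 - ((z+c)/Q)^2 := by
    have : 0 < Real.sqrt (1 - ((z+c)/Q)^2) := by rw [sα]; positivity
    exact Real.sqrt_pos.1 this
  have bβ : 0 < 1 - ((1+c*z)/Q)^2 := by
    have : 0 < Real.sqrt (1 - ((1+c*z)/Q)^2) := by rw [sβ]; positivity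
    exact Real.sqrt_pos.1 this
  have dα := d1.div (dQ.const_mul 2) (by rw [eQ]; positivity)
  have dβ := d2.div (dQ.const_mul 2) (by rw [eQ]; positivity)
  have dA := (Real.hasDerivAt_arcsin (x := (2*s+c)/(2*Real.sqrt (1+2*s*c)))
    (by rw [eα]; intro h; rw [h] at bα; norm_num at bα) (by rw [eα]; intro h; rw [h] at bα; norm_num at bα)).comp s dα
  have dB := (Real.hasDerivAt_arccos (x := (2+2*s*c-c^2)/(2*Real.sqrt (1+2*s*c)))
    (by rw [eβ]; intro h; rw [h] at bβ; norm_num at bβ) (by rw [eβ]; intro h; rw [h] at bβ; norm_num at bβ)).comp s dβ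
  have e4 : 4-(2*s-c)^2 = 4*(1-z^2) := by rw [hs]; ring
  have s4 : Real.sqrt (4-(2*s-c)^2) = 2*R := by
    rw [Real.sqrt_eq_iff_mul_self_eq_of_pos (by positivity), e4, ← R2]; ring
  have dC := d3.sqrt (by rw [e4]; positivity)
  have tot := ((((hasDerivAt_id s).mul dA).add (dB.const_mul (1/(2*c)))).add
    (dC.const_mul (1/4))).const_mul (2/π)
  have hh : hshape c = fun s => (2/π) * (s * Real.arcsin ((2*s+c)/(2*Real.sqrt (1+2*s*c)))
      + (1/(2*c)) * Real.arccos ((2+2*s*c-c^2)/(2*Real.sqrt (1+2*s*c)))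
      + (1/4) * Real.sqrt (4-(2*s-c)^2)) := by
    funext s; unfold hshape; rw [if_neg hc.ne']
  rw [hh]
  convert! tot using 1
  simp only [Function.comp_apply, Pi.div_apply, id]
  rw [eα, eβ, sα, sβ, s4, eQ]
  have key : s * (1 / (R / Q) * ((2 * (2 * Q) - (2 * s + c) * (2 * (2 * c / (2 * Q)))) / (2 * Q) ^ 2))
    + 1 / (2 * c) * (-(1 / (c * R / Q)) * ((2 * c * (2 * Q) - (2 + 2 * s * c - c ^ 2) * (2 * (2 * c / (2 * Q)))) / (2 * Q) ^ 2))
    + 1/4 * (-(4 * (2 * s - c)) / (2 * (2 * R))) = 0 := by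
    have hQ4 : Q^4 = (1+c^2+2*c*z)^2 := by rw [← Q2]; ring
    rw [hs]
    field_simp
    ring_nf
    try rw [Q2]
    ring
  linear_combination -(2/π) * key

lemma O_deriv_of_Ioo {c f' s p q : ℝ} {f : ℝ → ℝ} (h1 : p < s) (h2 : s < q)
    (he : ∀ x, p < x → x < q → Omega c x = f x) (hf : HasDerivAt f f' s) :
    deriv (Omega c) s = f' := by
  have : Omega c =ᶠ[𝓝 s] f := by
    filter_upwards [Ioo_mem_nhds h1 h2] with x hx using he x hx.1 hx.2
  exact (hf.congr_of_eventuallyEq this).deriv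

lemma O_le {c : ℝ} (hc : 0 < c) (hc1 : c ≤ 1) : ∀ᵐ s : ℝ, deriv (Omega c) s =
    sg (s - (c/2-1)) + (-(4/π) * Ar 1 (s - c/2) + (2/π) * Ar c (s - c/2)) := by
  have n : ∀ x : ℝ, ∀ᵐ s : ℝ, s ≠ x := fun x => Measure.ae_ne volume x
  filter_upwards [n (c/2-1), n (c/2+1)] with s h1 h2
  have hpi := Real.pi_pos
  rcases lt_or_gt_of_ne h1 with h1 | h1
  · have hz : 1 ≤ |s - c/2| := by rw [le_abs]; right; linarith
    rw [Ar_zero _ hz, Ar_zero _ hz]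
    have : sg (s - (c/2-1)) = -1 := by unfold sg; rw [if_pos (by linarith)]
    rw [this, O_deriv_of_Ioo (p := s-1) (q := c/2-1) (f' := -1) (f := fun x => -x) (by linarith) h1 ?_
      (hasDerivAt_neg s)]
    · ring
    · intro x _ hx
      unfold Omega
      rw [if_pos hc1, if_neg (by rintro ⟨h, _⟩; linarith), abs_of_neg (by linarith)]
  have sg1 : sg (s - (c/2-1)) = 1 := by unfold sg; rw [if_neg (by linarith)]
  rcases lt_or_gt_of_ne h2 with h2 | h2
  · rw [sg1]
    have hd := h_deriv hc (z := s - c/2) (by linarith) (by linarith)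
    rw [sub_add_cancel] at hd
    rw [O_deriv_of_Ioo (f := hshape c) h1 h2 ?_ hd, asin_le hc hc1 (by linarith) (by linarith)]
    · field_simp; ring
    · intro x h3 h4
      unfold Omega
      rw [if_pos hc1, if_pos ⟨by linarith, by linarith⟩]
  · have hz : 1 ≤ |s - c/2| := by rw [le_abs]; left; linarith
    rw [Ar_zero _ hz, Ar_zero _ hz, sg1, O_deriv_of_Ioo (p := c/2+1) (q := s+1) (f' := 1) (f := fun x => x) h2 (by linarith) ?_
      (hasDerivAt_id s)]
    · ring
    · intro x hx _
      unfold Omega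
      rw [if_pos hc1, if_neg (by rintro ⟨_, h⟩; linarith), abs_of_pos (by linarith)]

lemma O_gt {c : ℝ} (hc1 : 1 < c) : ∀ᵐ s : ℝ, deriv (Omega c) s =
    sg (s - (-(1/(2*c)))) + (-(2/π) * Ar (1/c) (s - c/2)) := by
  have hc : 0 < c := by linarith
  have n : ∀ x : ℝ, ∀ᵐ s : ℝ, s ≠ x := fun x => Measure.ae_ne volume x
  have hpi := Real.pi_pos
  have hnc : ¬ c ≤ 1 := not_le.2 hc1
  have e2 : 1/(2*c) = (1/c)/2 := by field_simp
  have hcp : 0 < 1/c := by positivity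
  have hord : -(1/c) < c - 2 := by
    have : c - 2 + 1/c = (c-1)^2/c := by field_simp; ring
    have h3 : 0 < (c-1)^2/c := by have : c - 1 ≠ 0 := by linarith
                                  positivity
    linarith
  filter_upwards [n (-(1/(2*c))), n (c/2-1), n (c/2+1)] with s h0 h1 h2
  rw [e2] at h0 ⊢
  rcases lt_or_gt_of_ne h0 with h0 | h0
  · have hz : 1 ≤ |s - c/2| := by rw [le_abs]; right; linarith
    rw [Ar_zero _ hz]
    have : sg (s - (-(1/c/2))) = -1 := by unfold sg; rw [if_pos (by linarith)]
    rw [this, O_deriv_of_Ioo (p := s-1) (q := -(1/c/2)) (f' := -1) (f := fun x => -x) (by linarith) h0 ?_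
      (hasDerivAt_neg s)]
    · ring
    · intro x _ hx
      unfold Omega
      rw [if_neg hnc, if_neg (by rintro ⟨h, _⟩; linarith), if_neg (by rintro ⟨h, _⟩; linarith), abs_of_neg (by linarith)]
  have sg1 : sg (s - (-(1/c/2))) = 1 := by unfold sg; rw [if_neg (by linarith)]
  rcases lt_or_gt_of_ne h1 with h1 | h1
  · have hz : 1 ≤ |s - c/2| := by rw [le_abs]; right; linarith
    rw [Ar_zero _ hz, sg1, O_deriv_of_Ioo (f' := 1) (f := fun x => x + 1/c) h0 h1 ?_
      ((hasDerivAt_id s).add_const _)]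
    · ring
    · intro x h3 h4
      unfold Omega
      rw [if_neg hnc, if_pos ⟨by linarith, by linarith⟩]
  rcases lt_or_gt_of_ne h2 with h2 | h2
  · rw [sg1]
    have hd := h_deriv hc (z := s - c/2) (by linarith) (by linarith)
    rw [sub_add_cancel] at hd
    rw [O_deriv_of_Ioo (f := hshape c) h1 h2 ?_ hd, asin_gt hc1 (by linarith) (by linarith)]
    · field_simp; ring
    · intro x h3 h4
      unfold Omega
      rw [if_neg hnc, if_neg (by rintro ⟨_, h⟩; linarith), if_pos ⟨by linarith, by linarith⟩]
  · have hz : 1 ≤ |s - c/2| := by rw [le_abs]; left; linarith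
    rw [Ar_zero _ hz, sg1, O_deriv_of_Ioo (p := c/2+1) (q := s+1) (f' := 1) (f := fun x => x) h2 (by linarith) ?_
      (hasDerivAt_id s)]
    · ring
    · intro x hx _
      unfold Omega
      rw [if_neg hnc, if_neg (by rintro ⟨_, h⟩; linarith), if_neg (by rintro ⟨_, h⟩; linarith), abs_of_pos (by linarith)]

lemma acosh_y {y : ℝ} (h0 : y ≠ 0) (h1 : |y| ≤ 1) : arccosh |(y + 1/y)/2| = -Real.log |y| := by
  have hp : 0 < |y| := abs_pos.2 h0
  have e : |(y + 1/y)/2| = (|y| + 1/|y|)/2 := by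
    rcases lt_or_gt_of_ne h0 with h | h
    · have : (y + 1/y)/2 ≤ 0 := by
        have : 1/y < 0 := one_div_neg.2 h
        linarith
      rw [abs_of_nonpos this, abs_of_neg h]
      field_simp; ring
    · rw [abs_of_pos h, abs_of_pos (by positivity)]
  rw [e]
  set p := |y|
  have h2 : 0 ≤ (1/p - p)/2 := by
    have : 1 ≤ 1/p := by rw [le_div_iff₀ hp]; linarith
    linarith
  unfold arccosh
  have s : Real.sqrt (((p+1/p)/2)^2 - 1) = (1/p-p)/2 := by
    rw [← Real.sqrt_sq h2]; congr 1; field_simp; ring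
  rw [s, ← Real.log_inv]; congr 1; field_simp; ring

lemma ex_q {z : ℝ} (hz : 1 < |z|) : ∃ q : ℝ, q ≠ 0 ∧ |q| < 1 ∧ q + 1/q = 2*z ∧
    Real.sign z * Real.sqrt (z^2-1) = z - q := by
  have hz2 : 1 < z^2 := by nlinarith [sq_abs z]
  set w := Real.sqrt (z^2-1) with hw
  have hw0 : 0 < w := Real.sqrt_pos.2 (by linarith)
  have w2 : w^2 = z^2-1 := Real.sq_sqrt (by linarith)
  rcases lt_abs.1 hz with h | h
  · have hprod : (z-w)*(z+w) = 1 := by linear_combination -w2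
    have hq : 0 < z - w := by
      by_contra hn
      have : (z-w)*(z+w) ≤ 0 := mul_nonpos_of_nonpos_of_nonneg (by linarith) (by linarith)
      linarith
    refine ⟨z - w, hq.ne', ?_, ?_, ?_⟩
    · rw [abs_of_pos hq]; nlinarith
    · have := hq.ne'
      rw [eq_div_of_mul_eq this (by linarith : (z+w)*(z-w) = 1) |>.symm]; ring
    · rw [Real.sign_of_pos (by linarith)]; ring
  · have hprod : (z+w)*(z-w) = 1 := by linear_combination -w2
    have hq : z + w < 0 := by
      by_contra hn
      have : (z+w)*(z-w) ≤ 0 := mul_nonpos_of_nonneg_of_nonpos (by linarith) (by linarith)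
      linarith
    refine ⟨z + w, hq.ne, ?_, ?_, ?_⟩
    · rw [abs_of_neg hq]; nlinarith
    · have := hq.ne
      rw [eq_div_of_mul_eq this (by linarith : (z-w)*(z+w) = 1) |>.symm]; ring
    · rw [Real.sign_of_neg (by linarith)]; ring

lemma q_facts {r z q : ℝ} (hr : 0 < r) (hr1 : r ≤ 1) (hq0 : q ≠ 0) (hq : |q| < 1)
    (hz : q + 1/q = 2*z) (hne : r + q ≠ 0) :
    0 < 1 + r*q ∧ 2*(z + (r+1/r)/2) = (1+r*q)*(r+q)/(r*q) ∧
    arccosh |(1 + (r+1/r)/2*z)/(z + (r+1/r)/2)| = Real.log (1+r*q) - Real.log |r+q| := by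
  have hq' := abs_lt.1 hq
  have hp : 0 < 1 + r*q := by nlinarith
  have hzz : z = (q + 1/q)/2 := by linarith
  refine ⟨hp, ?_, ?_⟩
  · rw [hzz]; field_simp; ring
  · set y := (r+q)/(1+r*q) with hy
    have hy0 : y ≠ 0 := div_ne_zero hne hp.ne'
    have hy1 : |y| ≤ 1 := by
      rw [hy, abs_div, abs_of_pos hp, div_le_one hp, abs_le]
      constructor <;> nlinarith
    have e : (1 + (r+1/r)/2*z)/(z + (r+1/r)/2) = (y + 1/y)/2 := by
      have hden : z + (r+1/r)/2 ≠ 0 := by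
        have : 2*(z + (r+1/r)/2) = (1+r*q)*(r+q)/(r*q) := by rw [hzz]; field_simp; ring
        intro h; rw [h, mul_zero] at this
        have h2 : (1+r*q)*(r+q)/(r*q) ≠ 0 := by
          apply div_ne_zero (mul_ne_zero hp.ne' hne) (mul_ne_zero hr.ne' hq0)
        exact h2 this.symm
      have hden2 : z + (r+1/r)/2 = (1+r*q)*(r+q)/(2*(r*q)) := by rw [hzz]; field_simp; ring
      rw [hden2, hzz, hy]
      have := hp.ne'
      field_simp
      ring
    rw [e, acosh_y hy0 hy1, hy, abs_div, abs_of_pos hp, Real.log_div (abs_ne_zero.2 hne) hp.ne']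
    ring

lemma G_form {c : ℝ} (hc : 0 < c) (z : ℝ) : Gc c (z + c/2) =
    (z + (c+1/c)/2) * (1 - Real.log (2*c*(z + (c+1/c)/2))) - (1-c^2)/(2*c) := by
  unfold Gc
  have e : (1+2*c*(z+c/2))/2 = c*(z + (c+1/c)/2) := by field_simp; ring
  rw [e, phi1_eq, ← mul_assoc]
  field_simp

lemma FGH_le {c : ℝ} (hc : 0 < c) (hc1 : c ≤ 1) {z : ℝ} (h1 : |z| ≠ 1) (h2 : z + (c+1/c)/2 ≠ 0) :
    2*phi1 (z+1) + (-(4/π) * Lf 1 z + (2/π) * Lf c z) = Gc c (z+c/2) - Hc c (z+c/2) := by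
  have hpi := Real.pi_pos.ne'
  have ek : (1+c^2)/(2*c) = (c+1/c)/2 := by field_simp; ring
  rw [G_form hc]
  unfold Hc Htilde
  rw [add_sub_cancel_right, ek]
  rcases lt_or_gt_of_ne h1 with h1 | h1
  · have hz := abs_lt.1 h1
    rw [if_pos h1.le, L_on one_pos le_rfl hz.1 hz.2, L_on hc hc1 hz.1 hz.2, phi1_eq]
    norm_num
    field_simp
    ring
  · rw [if_neg (not_le.2 h1)]
    obtain ⟨q, hq0, hq, hqz, hsgn⟩ := ex_q h1
    have hq' := abs_lt.1 hq
    have hzz : z = (q + 1/q)/2 := by linarith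
    have hne : c + q ≠ 0 := by
      intro h; apply h2
      have : q = -c := by linarith
      rw [hzz, this]; field_simp; ring
    have hne1 : 1 + q ≠ 0 := by linarith
    obtain ⟨hp, hk, hac⟩ := q_facts hc hc1 hq0 hq hqz hne
    obtain ⟨hp1, hk1, -⟩ := q_facts one_pos le_rfl hq0 hq hqz hne1
    have hL1 := L_off one_pos le_rfl hq0 hq hqz
    have hLc := L_off hc hc1 hq0 hq hqz
    have haz : arccosh |z| = -Real.log |q| := by rw [hzz]; exact acosh_y hq0 hq.le
    rw [hac, haz, hsgn, hL1, hLc, phi1_eq]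
    have l1 : Real.log (2*(z+1)) = 2*Real.log (1+q) - Real.log |q| := by
      have : 2*(z+1) = (1+q)*(1+q)/q := by norm_num at hk1; rw [← hk1]
      rw [this, Real.log_div (mul_ne_zero hne1 hne1) hq0, Real.log_mul hne1 hne1, Real.log_abs]; ring
    have l2 : Real.log (2*c*(z + (c+1/c)/2)) = Real.log (1+c*q) + Real.log |c+q| - Real.log |q| := by
      have : 2*c*(z + (c+1/c)/2) = (1+c*q)*(c+q)/q := by
        have : 2*c*(z + (c+1/c)/2) = c*(2*(z + (c+1/c)/2)) := by ring
        rw [this, hk]; field_simp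
      rw [this, Real.log_div (mul_ne_zero hp.ne' hne) hq0, Real.log_mul hp.ne' hne, Real.log_abs, Real.log_abs]
    have hs : Real.sign (1-c) * (z + (c+1/c)/2) * (Real.log (1+c*q) - Real.log |c+q|) =
        (z + (c+1/c)/2) * (Real.log (1+c*q) - Real.log |c+q|) := by
      rcases eq_or_lt_of_le hc1 with h | h
      · subst h
        rw [one_mul, abs_of_pos (by linarith)]; simp
      · rw [Real.sign_of_pos (by linarith), one_mul]
    rw [l1, l2, hs, one_mul]
    set A := Real.log |q|
    set B := Real.log (1+q)
    set C := Real.log (1+c*q)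
    set D := Real.log |c+q|
    field_simp
    ring

lemma FGH_gt {c : ℝ} (hc1 : 1 < c) {z : ℝ} (h1 : |z| ≠ 1) (h2 : z + (c+1/c)/2 ≠ 0) :
    2*phi1 (z + (c+1/c)/2) + (-(2/π) * Lf (1/c) z) = Gc c (z+c/2) - Hc c (z+c/2) := by
  have hpi := Real.pi_pos.ne'
  have hc : 0 < c := by linarith
  have ek : (1+c^2)/(2*c) = (c+1/c)/2 := by field_simp; ring
  have hr : 0 < 1/c := by positivity
  have hr1 : 1/c ≤ 1 := by rw [div_le_one hc]; exact hc1.le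
  have er : (1/c + 1/(1/c))/2 = (c+1/c)/2 := by field_simp; ring
  have lc : Real.log (1/c) = -Real.log c := by rw [one_div, Real.log_inv]
  rw [G_form hc]
  unfold Hc Htilde
  rw [add_sub_cancel_right, ek]
  have hK : Real.log (2*c*(z + (c+1/c)/2)) = Real.log c + Real.log (2*(z + (c+1/c)/2)) := by
    rw [← Real.log_mul hc.ne' (mul_ne_zero two_ne_zero h2)]; ring_nf
  rcases lt_or_gt_of_ne h1 with h1 | h1
  · have hz := abs_lt.1 h1
    have hK2 : Real.log (2*(1/c)*(z + (c+1/c)/2)) = -Real.log c + Real.log (2*(z + (c+1/c)/2)) := by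
      rw [← lc, ← Real.log_mul hr.ne' (mul_ne_zero two_ne_zero h2)]; ring_nf
    rw [if_pos h1.le, L_on hr hr1 hz.1 hz.2, phi1_eq, er, hK, hK2]
    set X := Real.log (2*(z + (c+1/c)/2))
    field_simp
    ring
  · rw [if_neg (not_le.2 h1)]
    obtain ⟨q, hq0, hq, hqz, hsgn⟩ := ex_q h1
    have hq' := abs_lt.1 hq
    have hzz : z = (q + 1/q)/2 := by linarith
    have hne : 1/c + q ≠ 0 := by
      intro h; apply h2
      have : q = -(1/c) := by linarith
      rw [hzz, this]; field_simp; ring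
    obtain ⟨hp, hk, hac⟩ := q_facts hr hr1 hq0 hq hqz hne
    have hLc := L_off hr hr1 hq0 hq hqz
    have haz : arccosh |z| = -Real.log |q| := by rw [hzz]; exact acosh_y hq0 hq.le
    rw [er] at hk hac hLc
    rw [hac, haz, hsgn, hLc, phi1_eq, hK]
    have l2 : Real.log (2*(z + (c+1/c)/2)) = Real.log (1+1/c*q) + Real.log |1/c+q| + Real.log c - Real.log |q| := by
      rw [hk, Real.log_div (mul_ne_zero hp.ne' hne) (mul_ne_zero hr.ne' hq0), Real.log_mul hp.ne' hne, Real.log_abs, Real.log_abs,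
        Real.log_mul hr.ne' hq0, lc]; ring
    rw [l2, Real.sign_of_neg (by linarith)]
    set A := Real.log |q|
    set C := Real.log (1+1/c*q)
    set D := Real.log |1/c+q|
    set E := Real.log c
    field_simp
    ring

lemma band_red (r : ℝ) {a b c : ℝ} (ha : a ≤ c/2-1) (hb : c/2+1 ≤ b) (g : ℝ → ℝ) :
    ∫ t in a..b, g t * Ar r (t - c/2) = ∫ u in (-1:ℝ)..1, g (u + c/2) * Ar r u := by
  have h := intervalIntegral.integral_comp_sub_right (a := a) (b := b)
    (fun u => g (u + c/2) * Ar r u) (c/2)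
  simp only [sub_add_cancel] at h
  rw [h, intervalIntegral.integral_of_le (by linarith), intervalIntegral.integral_of_le (by norm_num)]
  apply setIntegral_eq_of_subset_of_forall_sdiff_eq_zero measurableSet_Ioc
  · exact Set.Ioc_subset_Ioc (by linarith) (by linarith)
  · intro x hx
    have : 1 ≤ |x| := by
      rw [le_abs]
      by_contra hn
      push Not at hn
      apply hx.2
      exact ⟨by linarith [hn.2], hn.1.le⟩
    rw [Ar_zero r this, mul_zero]

lemma band_L (r : ℝ) {a b c : ℝ} (ha : a ≤ c/2-1) (hb : c/2+1 ≤ b) (s : ℝ) :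
    ∫ t in a..b, phi0 (s - t) * Ar r (t - c/2) = Lf r (s - c/2) := by
  rw [band_red r ha hb]
  unfold Lf
  congr 1; funext u; congr 2; ring

lemma band_red' {u : ℝ → ℝ} (hu : ∀ x, 1 ≤ |x| → u x = 0) {a b c : ℝ} (ha : a ≤ c/2-1)
    (hb : c/2+1 ≤ b) (g : ℝ → ℝ) :
    ∫ t in a..b, g t * u (t - c/2) = ∫ x in (-1:ℝ)..1, g (x + c/2) * u x := by
  have h := intervalIntegral.integral_comp_sub_right (a := a) (b := b)
    (fun x => g (x + c/2) * u x) (c/2)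
  simp only [sub_add_cancel] at h
  rw [h, intervalIntegral.integral_of_le (by linarith), intervalIntegral.integral_of_le (by norm_num)]
  apply setIntegral_eq_of_subset_of_forall_sdiff_eq_zero measurableSet_Ioc
  · exact Set.Ioc_subset_Ioc (by linarith) (by linarith)
  · intro x hx
    have : 1 ≤ |x| := by
      rw [le_abs]
      by_contra hn
      push Not at hn
      apply hx.2
      exact ⟨by linarith [hn.2], hn.1.le⟩
    rw [hu x this, mul_zero]

lemma Lf_int {r : ℝ} (hr : 0 < r) (hr1 : r ≤ 1) : IntervalIntegrable (Lf r) volume (-1) 1 := by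
  have h : IntervalIntegrable (fun z => (π/2) * (r + z - (z + (r+1/r)/2) *
      Real.log (2*r*(z + (r+1/r)/2)))) volume (-1) 1 := by
    apply Continuous.intervalIntegrable
    have := xlog_cont hr
    fun_prop
  refine h.congr_ae ?_
  rw [Filter.EventuallyEq, ae_restrict_iff' measurableSet_uIoc]
  filter_upwards [Measure.ae_ne volume (1:ℝ)] with z hz hm
  rw [Set.uIoc_of_le (by norm_num)] at hm
  exact (L_on hr hr1 hm.1 (lt_of_le_of_ne hm.2 hz)).symm

lemma K_le {c : ℝ} (hc : 0 < c) (hc1 : c ≤ 1) :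
    ∫ z in (-1:ℝ)..1, (4*phi1 (z+1) + (-(4/π) * Lf 1 z + (2/π) * Lf c z)) *
      (-(4/π) * Ar 1 z + (2/π) * Ar c z) = -(1 - c^2/4) := by
  have hpi := Real.pi_pos.ne'
  have e : ∫ z in (-1:ℝ)..1, (4*phi1 (z+1) + (-(4/π) * Lf 1 z + (2/π) * Lf c z)) *
      (-(4/π) * Ar 1 z + (2/π) * Ar c z) = ∫ z in (-1:ℝ)..1,
      (-(16/π^2) * (Lf 1 z * Ar 1 z) + (8/π^2) * (Lf 1 z * Ar c z)
        + (-(8/π^2)) * (Lf c z * Ar 1 z) + (4/π^2) * (Lf c z * Ar c z)) := by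
    apply intervalIntegral.integral_congr_Ioo_of_le (by norm_num)
    intro z hz
    have h1 : phi1 (z+1) = (2/π) * Lf 1 z := by
      rw [L_on one_pos le_rfl hz.1 hz.2, phi1_eq]; norm_num; field_simp; ring
    simp only [h1]
    field_simp; ring
  have i11 := (band_mul_int 1 _ (Lf_int one_pos le_rfl)).const_mul (-(16/π^2))
  have i1c := (band_mul_int c _ (Lf_int one_pos le_rfl)).const_mul (8/π^2)
  have ic1 := (band_mul_int 1 _ (Lf_int hc hc1)).const_mul (-(8/π^2))
  have icc := (band_mul_int c _ (Lf_int hc hc1)).const_mul (4/π^2)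
  rw [e, intervalIntegral.integral_add ((i11.add i1c).add ic1) icc,
    intervalIntegral.integral_add (i11.add i1c) ic1, intervalIntegral.integral_add i11 i1c]
  simp only [intervalIntegral.integral_const_mul]
  rw [f_val one_pos le_rfl, f_val hc hc1, L_symm 1 c]
  field_simp; ring

lemma K_gt {r : ℝ} (hr : 0 < r) (hr1 : r ≤ 1) :
    ∫ z in (-1:ℝ)..1, (4*phi1 (z + (r+1/r)/2) + (-(2/π) * Lf r z)) *
      (-(2/π) * Ar r z) = -(2 - 5*r^2/4 + (2+r^2) * Real.log r) := by
  have hpi := Real.pi_pos.ne'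
  have e : ∫ z in (-1:ℝ)..1, (4*phi1 (z + (r+1/r)/2) + (-(2/π) * Lf r z)) *
      (-(2/π) * Ar r z) = ∫ z in (-1:ℝ)..1,
      (-(12/π^2) * (Lf r z * Ar r z) + (-(8/π)*((r+1/r)/2 - r + (r+1/r)/2 * Real.log r)) * Ar r z
        + (-(8/π) * Real.log r) * (z * Ar r z)) := by
    apply intervalIntegral.integral_congr_Ioo_of_le (by norm_num)
    intro z hz
    have hne : 2*(z + (r+1/r)/2) ≠ 0 := by
      have : 0 < 2*(z + (r+1/r)/2) := by
        have : 2*(z + (r+1/r)/2) = 2*(z+1) + (1-r)^2/r := by field_simp; ring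
        rw [this]
        have := hz.1
        have h3 : 0 ≤ (1-r)^2/r := by positivity
        linarith
      exact this.ne'
    have h1 : phi1 (z + (r+1/r)/2) = (2/π) * Lf r z + ((r+1/r)/2 - r) + (z + (r+1/r)/2) * Real.log r := by
      have hl : Real.log (2*r*(z + (r+1/r)/2)) = Real.log r + Real.log (2*(z + (r+1/r)/2)) := by
        rw [← Real.log_mul hr.ne' hne]; ring_nf
      rw [L_on hr hr1 hz.1 hz.2, phi1_eq, hl]
      set X := Real.log (2*(z + (r+1/r)/2))
      field_simp; ring
    simp only [h1]
    field_simp; ring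
  have i1 := (band_mul_int r _ (Lf_int hr hr1)).const_mul (-(12/π^2))
  have i2 := band_mul_int r (a := -1) (b := 1) (fun _ => (-(8/π)*((r+1/r)/2 - r + (r+1/r)/2 * Real.log r))) _root_.intervalIntegrable_const
  have i3 := (band_mul_int r (a := -1) (b := 1) (fun t => t) (continuous_id.intervalIntegrable _ _)).const_mul (-(8/π) * Real.log r)
  rw [e, intervalIntegral.integral_add (i1.add i2) i3, intervalIntegral.integral_add i1 i2]
  simp only [intervalIntegral.integral_const_mul]
  rw [f_val hr hr1, Am1 hr.le hr1, Am2 hr.le hr1]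
  field_simp; ring

lemma Gc_cont (c : ℝ) : Continuous (Gc c) := by
  unfold Gc
  have := phi1_cont
  fun_prop

lemma assemble {c a b x0 K : ℝ} (ha : a < x0) (hb : x0 < b) (v : ℝ → ℝ) (hv : Measurable v)
    (M : ℝ) (hM : ∀ x, |v x| ≤ M)
    (hO : ∀ᵐ s : ℝ, deriv (Omega c) s = sg (s - x0) + v s)
    (hF : ∀ᵐ s : ℝ, 2*phi1 (s-x0) + (∫ t in a..b, phi0 (s-t) * v t) = Gc c s - Hc c s)
    (hK : ∫ s in a..b, (4*phi1 (s-x0) + ∫ t in a..b, phi0 (s-t) * v t) * v s = -K) :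
    (∫ s in a..b,
          (∫ t in a..b, phi0 (s - t) * deriv (Omega c) t) * deriv (Omega c) s) =
        K - 2*phi2 (b-a)
        + 2*(∫ s in a..b, Gc c s * deriv (Omega c) s)
        - 2*(∫ s in a..b, Hc c s * deriv (Omega c) s) := by
  obtain ⟨hI, hmain⟩ := abs_main ha hb v hv M hM
  have e0 : ∀ s, ∫ t in a..b, phi0 (s - t) * deriv (Omega c) t =
      ∫ t in a..b, phi0 (s - t) * (sg (t-x0) + v t) := by
    intro s
    apply intervalIntegral.integral_congr_ae
    filter_upwards [hO] with t ht _
    rw [ht]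
  have e1 : ∀ f : ℝ → ℝ, ∫ s in a..b, f s * deriv (Omega c) s =
      ∫ s in a..b, f s * (sg (s-x0) + v s) := by
    intro f
    apply intervalIntegral.integral_congr_ae
    filter_upwards [hO] with t ht _
    rw [ht]
  simp only [e0]
  rw [e1, e1, e1, hmain, hK]
  have hGI : IntervalIntegrable (fun s => Gc c s * (sg (s-x0) + v s)) volume a b := by
    have h := (Gc_cont c).intervalIntegrable (μ := volume) a b
    rw [intervalIntegrable_iff] at h ⊢
    refine Integrable.mul_bdd (c := 1 + M) h ?_ (Filter.Eventually.of_forall fun t => ?_)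
    · exact ((sg_meas.comp (by fun_prop)).add hv).aestronglyMeasurable
    · exact (abs_add_le _ _).trans (add_le_add (sg_abs _) (hM _))
  have e2 : ∫ s in a..b, Hc c s * (sg (s-x0) + v s) = ∫ s in a..b,
      (Gc c s * (sg (s-x0) + v s) -
        (2*phi1 (s-x0) + ∫ t in a..b, phi0 (s-t) * v t) * (sg (s-x0) + v s)) := by
    apply intervalIntegral.integral_congr_ae
    filter_upwards [hF] with t ht _
    rw [ht]; ring
  rw [e2, intervalIntegral.integral_sub hGI hI]
  ring

lemma phiA_int (r s c a b : ℝ) :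
    IntervalIntegrable (fun t => phi0 (s - t) * Ar r (t - c/2)) volume a b := by
  have h := phi0_shift_int s a b
  rw [intervalIntegrable_iff] at h ⊢
  exact Integrable.mul_bdd (c := π/2) h ((Ar_meas r).comp (by fun_prop)).aestronglyMeasurable
      (Filter.Eventually.of_forall fun t => Ar_abs _ _)

lemma ae_good (c κ : ℝ) : ∀ᵐ s : ℝ, |s - c/2| ≠ 1 ∧ s - c/2 + κ ≠ 0 := by
  have n : ∀ x : ℝ, ∀ᵐ s : ℝ, s ≠ x := fun x => Measure.ae_ne volume x
  filter_upwards [n (c/2+1), n (c/2-1), n (c/2-κ)] with s h1 h2 h3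
  refine ⟨fun h => ?_, fun h => h3 (by linarith)⟩
  rcases eq_or_eq_neg_of_abs_eq h with h | h
  · exact h1 (by linarith)
  · exact h2 (by linarith)

lemma main_le {c a b : ℝ} (hc : 0 < c) (hc1 : c ≤ 1) (ha : a < c/2-1) (hb : c/2+1 < b) :
    (∫ s in a..b,
          (∫ t in a..b, phi0 (s - t) * deriv (Omega c) t) * deriv (Omega c) s) =
        1 - c^2/4 - 2*phi2 (b-a)
        + 2*(∫ s in a..b, Gc c s * deriv (Omega c) s)
        - 2*(∫ s in a..b, Hc c s * deriv (Omega c) s) := by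
  set u : ℝ → ℝ := fun z => -(4/π) * Ar 1 z + (2/π) * Ar c z with hu
  have hpi := Real.pi_pos
  have hum : Measurable u := ((Ar_meas 1).const_mul _).add ((Ar_meas c).const_mul _)
  have hV : ∀ s, ∫ t in a..b, phi0 (s-t) * u (t - c/2) =
      -(4/π) * Lf 1 (s - c/2) + (2/π) * Lf c (s - c/2) := by
    intro s
    have e : ∀ t, phi0 (s-t) * u (t - c/2) = -(4/π) * (phi0 (s-t) * Ar 1 (t-c/2)) +
      (2/π) * (phi0 (s-t) * Ar c (t-c/2)) := by intro t; simp only [hu]; ring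
    simp only [e]
    rw [intervalIntegral.integral_add ((phiA_int _ _ _ _ _).const_mul _) ((phiA_int _ _ _ _ _).const_mul _)]
    simp only [intervalIntegral.integral_const_mul]
    rw [band_L 1 ha.le hb.le, band_L c ha.le hb.le]
  apply assemble (x0 := c/2-1) ha (by linarith) (fun s => u (s - c/2)) (hum.comp (by fun_prop))
    (4/π*(π/2) + 2/π*(π/2)) ?_ (O_le hc hc1) ?_ ?_
  · intro x
    refine (abs_add_le _ _).trans (add_le_add ?_ ?_)
    · rw [abs_mul, abs_neg, abs_of_pos (by positivity)]
      exact mul_le_mul_of_nonneg_left (Ar_abs _ _) (by positivity)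
    · rw [abs_mul, abs_of_pos (by positivity)]
      exact mul_le_mul_of_nonneg_left (Ar_abs _ _) (by positivity)
  · filter_upwards [ae_good c ((c+1/c)/2)] with s hs
    have := FGH_le hc hc1 hs.1 hs.2
    rw [hV]
    rw [sub_add_cancel] at this
    rw [← this]
    congr 3; ring
  · simp only [hV]
    rw [band_red' (u := u) ?_ ha.le hb.le (fun s => 4*phi1 (s - (c/2-1)) + (-(4/π) * Lf 1 (s - c/2) + (2/π) * Lf c (s - c/2)))]
    · rw [← K_le hc hc1]
      congr 1; funext z
      simp only [hu, add_sub_cancel_right]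
      congr 4; ring
    · intro x hx
      simp only [hu, Ar_zero _ hx]; ring

lemma main_gt {c a b : ℝ} (hc1 : 1 < c) (ha : a < c/2-1) (ha2 : a < -(1/(2*c))) (hb : c/2+1 < b) :
    (∫ s in a..b,
          (∫ t in a..b, phi0 (s - t) * deriv (Omega c) t) * deriv (Omega c) s) =
        (2 - 5*(1/c)^2/4 + (2+(1/c)^2) * Real.log (1/c)) - 2*phi2 (b-a)
        + 2*(∫ s in a..b, Gc c s * deriv (Omega c) s)
        - 2*(∫ s in a..b, Hc c s * deriv (Omega c) s) := by
  have hc : 0 < c := by linarith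
  have hr : 0 < 1/c := by positivity
  have hr1 : 1/c ≤ 1 := by rw [div_le_one hc]; exact hc1.le
  set u : ℝ → ℝ := fun z => -(2/π) * Ar (1/c) z with hu
  have hpi := Real.pi_pos
  have hum : Measurable u := ((Ar_meas _).const_mul _)
  have hV : ∀ s, ∫ t in a..b, phi0 (s-t) * u (t - c/2) = -(2/π) * Lf (1/c) (s - c/2) := by
    intro s
    have e : ∀ t, phi0 (s-t) * u (t - c/2) = -(2/π) * (phi0 (s-t) * Ar (1/c) (t-c/2)) := by
      intro t; simp only [hu]; ring
    simp only [e]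
    rw [intervalIntegral.integral_const_mul, band_L _ ha.le hb.le]
  have hx : -(1/(2*c)) < b := by
    have : 0 < 1/(2*c) := by positivity
    linarith
  have ex : ∀ z : ℝ, z + c/2 - -(1/(2*c)) = z + (c+1/c)/2 := by intro z; field_simp; ring
  apply assemble (x0 := -(1/(2*c))) ha2 hx (fun s => u (s - c/2)) (hum.comp (by fun_prop))
    (2/π*(π/2)) ?_ (O_gt hc1) ?_ ?_
  · intro x
    simp only [hu]
    rw [abs_mul, abs_neg, abs_of_pos (by positivity)]
    exact mul_le_mul_of_nonneg_left (Ar_abs _ _) (by positivity)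
  · filter_upwards [ae_good c ((c+1/c)/2)] with s hs
    have := FGH_gt hc1 hs.1 hs.2
    rw [hV]
    rw [sub_add_cancel, ← ex, sub_add_cancel] at this
    exact this
  · simp only [hV]
    rw [band_red' (u := u) ?_ ha.le hb.le (fun s => 4*phi1 (s - -(1/(2*c))) + (-(2/π) * Lf (1/c) (s - c/2)))]
    · rw [← K_gt hr hr1]
      congr 1; funext z
      simp only [hu, add_sub_cancel_right, ex]
      congr 4; rw [one_div_one_div]; ring
    · intro x hx
      simp only [hu, Ar_zero _ hx]; ring

/-- For `c > 0`, `a < min(−1+c/2, −1/(2c))`, `b > 1+c/2`, with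
`I_c(s) = ∫_a^b φ₀(s−t)·Ω_c′(t) dt`:
`∫_a^b I_c(s)·Ω_c′(s) ds = 1 − c²/4 − 2φ₂(b−a) + 2∫_a^b G_c·Ω_c′ − 2∫_a^b H_c·Ω_c′
  + [c>1](1 − 5/(4c²) + c²/4 − (2+1/c²)·ln c)`. -/
theorem integral_Ic_Omega_deriv :
    ∀ c a b : ℝ, 0 < c → a < min (-1 + c/2) (-(1/(2*c))) → 1 + c/2 < b →
      (∫ s in a..b,
          (∫ t in a..b, phi0 (s - t) * deriv (Omega c) t) * deriv (Omega c) s) =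
        1 - c^2/4 - 2*phi2 (b-a)
        + 2*(∫ s in a..b, Gc c s * deriv (Omega c) s)
        - 2*(∫ s in a..b, Hc c s * deriv (Omega c) s)
        + (if 1 < c then 1 - 5/(4*c^2) + c^2/4 - (2 + 1/c^2)*Real.log c else 0) := by
  intro c a b hc ha hb
  have h1 : a < c/2-1 := by have := lt_of_lt_of_le ha (min_le_left _ _); linarith
  have h2 := lt_of_lt_of_le ha (min_le_right _ _)
  by_cases hc1 : 1 < c
  · rw [if_pos hc1, main_gt hc1 h1 h2 (by linarith)]
    rw [one_div c, Real.log_inv, inv_pow]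
    ring
  · rw [if_neg hc1, main_le hc (not_lt.1 hc1) h1 (by linarith), add_zero]
end
end

section
/- For every c > 0: (1/(4π))·∫_{−1}^1 ln(1+c²+2cz)·(1+c²+2cz)·(1+cz)/√(1−z²) dz equals (3/4)c² + c⁴/8 if 0 < c ≤ 1, and equals 5/8 + c²/4 + (ln c)/2 + c²·ln c if c ≥ 1. -/
open MeasureTheory Real Filter Topology
open scoped Classical

noncomputable section

lemma aux_D_pos (c : ℝ) (hc : 0 < c) (h1 : c ≠ 1) (t : ℝ) : 0 < 1 + c^2 + 2*c*cos t := by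
  have h := neg_one_le_cos t
  have h2 : 0 < (1-c)^2 := by
    have : (1 - c) ≠ 0 := fun h => h1 (by linarith)
    positivity
  nlinarith

lemma aux_subst (g : ℝ → ℝ) :
    ∫ z in (-1:ℝ)..1, g z / Real.sqrt (1-z^2) = ∫ t in (0:ℝ)..π, g (cos t) := by
  rw [intervalIntegral.integral_of_le (by norm_num), intervalIntegral.integral_of_le pi_pos.le,
    integral_Ioc_eq_integral_Ioo, integral_Ioc_eq_integral_Ioo]
  have him : cos '' (Set.Ioo 0 π) = Set.Ioo (-1) 1 := by
    ext x
    constructor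
    · rintro ⟨t, ⟨h0, h1⟩, rfl⟩
      constructor
      · rw [← cos_pi]
        exact cos_lt_cos_of_nonneg_of_le_pi h0.le le_rfl h1
      · rw [← cos_zero]
        exact cos_lt_cos_of_nonneg_of_le_pi le_rfl h1.le h0
    · rintro ⟨h0, h1⟩
      exact ⟨arccos x, ⟨arccos_pos.2 h1, arccos_lt_pi.2 h0⟩, cos_arccos h0.le h1.le⟩
  rw [← him, integral_image_eq_integral_abs_deriv_smul measurableSet_Ioo
    (fun x _ => (hasDerivAt_cos x).hasDerivWithinAt)
    (injOn_cos.mono Set.Ioo_subset_Icc_self)]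
  refine setIntegral_congr_fun measurableSet_Ioo fun t ht => ?_
  have hs := sin_pos_of_mem_Ioo ht
  have : 1 - cos t ^ 2 = sin t ^ 2 := by linarith [sin_sq_add_cos_sq t]
  simp only [smul_eq_mul, abs_neg, abs_of_pos hs, this, sqrt_sq hs.le]
  field_simp

lemma aux_cont_log (c : ℝ) (hc : 0 < c) (h1 : c ≠ 1) :
    Continuous fun t => log (1 + c^2 + 2*c*cos t) :=
  Continuous.log (by fun_prop) fun t => (aux_D_pos c hc h1 t).ne'

lemma aux_I0 (c : ℝ) (hc : 0 < c) (h1 : c ≠ 1) :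
    ∫ t in (0:ℝ)..π, log (1 + c^2 + 2*c*cos t) = 2 * π * log⁺ c := by
  have h := circleAverage_log_norm_add_const_eq_posLog (a := (c:ℂ))
  rw [circleAverage_def] at h
  have e : ∀ t : ℝ, log ‖circleMap 0 1 t + (c:ℂ)‖ = (1/2) * log (1 + c^2 + 2*c*cos t) := by
    intro t
    have : ‖circleMap 0 1 t + (c:ℂ)‖ ^ 2 = 1 + c^2 + 2*c*cos t := by
      rw [← Complex.normSq_eq_norm_sq, Complex.normSq_apply]
      simp [circleMap, Complex.exp_ofReal_mul_I_re, Complex.exp_ofReal_mul_I_im]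
      linarith [sin_sq_add_cos_sq t]
    rw [← this, log_pow]
    push_cast
    ring
  simp only [e, smul_eq_mul, Complex.norm_real, norm_eq_abs, abs_of_pos hc] at h
  rw [intervalIntegral.integral_const_mul] at h
  have hci := aux_cont_log c hc h1
  have hsplit := intervalIntegral.integral_add_adjacent_intervals
    (hci.intervalIntegrable (μ := volume) 0 π) (hci.intervalIntegrable π (2*π))
  have hsym : ∫ t in π..(2*π), log (1 + c^2 + 2*c*cos t)
      = ∫ t in (0:ℝ)..π, log (1 + c^2 + 2*c*cos t) := by
    have := intervalIntegral.integral_comp_sub_left (a := (0:ℝ)) (b := π)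
      (fun t => log (1 + c^2 + 2*c*cos t)) (2*π)
    simp only [cos_two_pi_sub, sub_zero] at this
    rw [this]
    congr 1
    ring
  rw [hsym] at hsplit
  rw [← hsplit] at h
  field_simp at h
  linarith

lemma aux_main (c : ℝ) (hc : 0 < c) (h1 : c ≠ 1) (B : ℝ → ℝ) (m : ℝ)
    (hB : ∀ t ∈ Set.uIcc 0 π, HasDerivAt B (m / (1 + c^2 + 2*c*cos t)) t)
    (hB0 : B 0 = 0) (hBpi : B π = π) (hm : m^2 = (1-c^2)^2) :
    ∫ t in (0:ℝ)..π, log (1+c^2+2*c*cos t) * (1+c^2+2*c*cos t) * (1+c*cos t)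
      = (1+2*c^2) * (2*π*log⁺ c) + π*(c^2/2 + (5+c^2)*(1+c^2)/4 - m*(5+c^2)/4) := by
  have hci := aux_cont_log c hc h1
  have hD := aux_D_pos c hc h1
  have hcont : Continuous fun t => log (1+c^2+2*c*cos t) * (1+c^2+2*c*cos t) * (1+c*cos t) := by
    fun_prop
  have key : ∫ t in (0:ℝ)..π, (log (1+c^2+2*c*cos t) * (1+c^2+2*c*cos t) * (1+c*cos t)
      - (1+2*c^2) * log (1+c^2+2*c*cos t)) =
      π*(c^2/2 + (5+c^2)*(1+c^2)/4 - m*(5+c^2)/4) := by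
    let G : ℝ → ℝ := fun t => log (1+c^2+2*c*cos t) * ((3*c+c^3)*sin t + c^2*(sin t*cos t))
      + (c^2 + (5+c^2)*(1+c^2)/4) * t - (5*c+c^3)/2 * sin t - c^2/2*(t+sin t*cos t)
      - m*(5+c^2)/4 * B t
    have hG : ∀ t ∈ Set.uIcc 0 π, HasDerivAt G
        (log (1+c^2+2*c*cos t) * (1+c^2+2*c*cos t) * (1+c*cos t)
        - (1+2*c^2) * log (1+c^2+2*c*cos t)) t := by
      intro t ht
      have hc' := hasDerivAt_cos t
      have hs' := hasDerivAt_sin t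
      have hL := ((hc'.const_mul (2*c)).const_add (1+c^2)).log (hD t).ne'
      have hsc := hs'.mul hc'
      have := ((((hL.mul ((hs'.const_mul (3*c+c^3)).add (hsc.const_mul (c^2)))).add
        ((hasDerivAt_id t).const_mul (c^2 + (5+c^2)*(1+c^2)/4))).sub
        (hs'.const_mul ((5*c+c^3)/2))).sub (((hasDerivAt_id t).add hsc).const_mul (c^2/2))).sub
        ((hB t ht).const_mul (m*(5+c^2)/4))
      refine this.congr_deriv ?_
      have hne := (hD t).ne'
      simp only [Pi.mul_apply, Pi.add_apply]
      have hss : sin t * sin t = 1 - cos t ^ 2 := by linarith [sin_sq_add_cos_sq t]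
      generalize log (1+c^2+2*c*cos t) = L
      generalize cos t = x at *
      generalize sin t = y at *
      field_simp
      have hy : y^2 = 1 - x^2 := by linarith
      grind
    rw [intervalIntegral.integral_eq_sub_of_hasDerivAt hG
      ((hcont.sub (continuous_const.mul hci)).intervalIntegrable _ _)]
    simp only [G, hB0, hBpi, sin_zero, sin_pi]
    ring
  rw [intervalIntegral.integral_sub (hcont.intervalIntegrable _ _)
    ((hci.intervalIntegrable _ _).const_mul (1+2*c^2)),
    intervalIntegral.integral_const_mul, aux_I0 c hc h1] at key
  linarith

lemma aux_lt (c : ℝ) (hc : 0 < c) (h1 : c < 1) :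
    ∫ t in (0:ℝ)..π, log (1+c^2+2*c*cos t) * (1+c^2+2*c*cos t) * (1+c*cos t)
      = 4*π*((3/4)*c^2 + c^4/8) := by
  rw [aux_main c hc h1.ne (fun t => t - 2 * arctan (c * sin t / (1 + c * cos t))) (1-c^2) ?_
    (by simp) (by simp) rfl, posLog_eq_zero_iff _ |>.2 (by rw [abs_of_pos hc]; exact h1.le)]
  · ring
  · intro t _
    have hD := aux_D_pos c hc h1.ne t
    have hE : 0 < 1 + c * cos t := by nlinarith [neg_one_le_cos t]
    have := (hasDerivAt_id t).sub (((((hasDerivAt_sin t).const_mul c).div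
      (((hasDerivAt_cos t).const_mul c).const_add 1) hE.ne').arctan).const_mul 2)
    refine this.congr_deriv ?_
    have hy : sin t ^ 2 = 1 - cos t ^ 2 := by linarith [sin_sq_add_cos_sq t]
    have e : 1 + (c * sin t / (1 + c * cos t))^2
        = (1 + c^2 + 2*c*cos t) / (1 + c * cos t)^2 := by
      field_simp
      rw [hy]; ring
    simp only [Pi.div_apply, e]
    field_simp
    grind

lemma aux_gt (c : ℝ) (h1 : 1 < c) :
    ∫ t in (0:ℝ)..π, log (1+c^2+2*c*cos t) * (1+c^2+2*c*cos t) * (1+c*cos t)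
      = 4*π*(5/8 + c^2/4 + Real.log c/2 + c^2*Real.log c) := by
  have hc : 0 < c := by linarith
  rw [aux_main c hc h1.ne' (fun t => t - 2 * arctan (sin t / (c + cos t))) (c^2-1) ?_
    (by simp) (by simp) (by ring), posLog_eq_log (by rw [abs_of_pos hc]; exact h1.le)]
  · ring
  · intro t _
    have hD := aux_D_pos c hc h1.ne' t
    have hE : 0 < c + cos t := by nlinarith [neg_one_le_cos t]
    have := (hasDerivAt_id t).sub (((((hasDerivAt_sin t)).div
      (((hasDerivAt_cos t)).const_add c) hE.ne').arctan).const_mul 2)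
    refine this.congr_deriv ?_
    have hy : sin t ^ 2 = 1 - cos t ^ 2 := by linarith [sin_sq_add_cos_sq t]
    have e : 1 + (sin t / (c + cos t))^2
        = (1 + c^2 + 2*c*cos t) / (c + cos t)^2 := by
      field_simp
      rw [hy]; ring
    simp only [Pi.div_apply, e]
    field_simp
    grind

lemma aux_one :
    ∫ t in (0:ℝ)..π, log (1+(1:ℝ)^2+2*1*cos t) * (1+1^2+2*1*cos t) * (1+1*cos t)
      = 4*π*((3/4)*1^2 + 1^4/8) := by
  have hF : Continuous fun c : ℝ =>
      ∫ t in (0:ℝ)..π, log (1+c^2+2*c*cos t) * (1+c^2+2*c*cos t) * (1+c*cos t) := by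
    apply intervalIntegral.continuous_parametric_intervalIntegral_of_continuous'
    have h2 : Continuous fun p : ℝ × ℝ => (1+p.1^2+2*p.1*cos p.2) := by fun_prop
    have h3 := continuous_mul_log.comp h2
    have h4 : Continuous fun p : ℝ × ℝ => (1+p.1*cos p.2) := by fun_prop
    refine (h3.mul h4).congr fun p => ?_
    simp only [Pi.mul_apply, Function.comp_apply, Function.uncurry]
    ring
  have hP : Continuous fun c : ℝ => 4*π*((3/4)*c^2 + c^4/8) := by fun_prop
  have l1 := (hF.tendsto 1).mono_left (nhdsWithin_le_nhds (s := Set.Iio 1))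
  have l2 := (hP.tendsto 1).mono_left (nhdsWithin_le_nhds (s := Set.Iio 1))
  refine tendsto_nhds_unique_of_eventuallyEq l1 l2 ?_
  filter_upwards [Ioo_mem_nhdsLT (show (0:ℝ) < 1 by norm_num)] with c hc
  exact aux_lt c hc.1 hc.2



/-- For `c > 0`,
`(1/(4π))∫_{−1}^1 ln(1+c²+2cz)(1+c²+2cz)(1+cz)/√(1−z²) dz`
equals `(3/4)c² + c⁴/8` if `0 < c ≤ 1` and `5/8 + c²/4 + (ln c)/2 + c²·ln c` if `c ≥ 1`. -/
theorem log_weighted_integral_big :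
    ∀ c : ℝ, 0 < c →
      (c ≤ 1 →
        (1/(4*π)) * (∫ z in (-1:ℝ)..1,
            Real.log (1+c^2+2*c*z) * (1+c^2+2*c*z) * (1+c*z) / Real.sqrt (1-z^2)) =
          (3/4)*c^2 + c^4/8) ∧
      (1 ≤ c →
        (1/(4*π)) * (∫ z in (-1:ℝ)..1,
            Real.log (1+c^2+2*c*z) * (1+c^2+2*c*z) * (1+c*z) / Real.sqrt (1-z^2)) =
          5/8 + c^2/4 + Real.log c/2 + c^2*Real.log c) := by

  intro c hc
  have hs := aux_subst (fun z => Real.log (1+c^2+2*c*z) * (1+c^2+2*c*z) * (1+c*z))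
  rw [hs]
  have hpi := pi_pos.ne'
  constructor
  · intro h
    rcases h.lt_or_eq with h | rfl
    · rw [aux_lt c hc h]
      field_simp
    · rw [aux_one]
      field_simp
  · intro h
    rcases h.lt_or_eq with h | rfl
    · rw [aux_gt c h]
      field_simp
    · rw [aux_one, log_one]
      field_simp
      norm_num
end
end
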